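/- Let G : I × [0,1] → I be a C² family of C² unimodal maps g_t of I = [-1,1], and suppose g_0 has a parabolic periodic point p (a point of period k ≥ 1 with |(g_0^k)'(p)| = 1) whose orbit attracts the critical orbit but is disjoint from it: dist(g_0^n(c), Orb(p)) → 0 as n → ∞ and g_0^n(c) ∉ Orb(p) for all n ≥ 0, where c is the turning point of g_0. Then, with h(t) the topological entropy of g_t, the Hölder exponent of h at t = 0 is infinite: for every β > 0 there exists C > 0 such that |h(t) − h(0)| ≤ C t^β for all t ∈ [0,1]. -/

import Mathlib

open Filter Set MeasureTheory

/-- Topological entropy of a map `g` on a set `s`. -/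
noncomputable def entropyOn (g : ℝ → ℝ) (s : Set ℝ) : ℝ :=
  (Dynamics.coverEntropy g s).toReal

/-- `g` is a C² unimodal map of `I = [-1,1]` with turning point `c`:
`g` maps `I` into `I` and `∂I` into `∂I`, is C² on `I`, its derivative vanishes on `I`
exactly at `c`, and `g` is strictly monotone on each side of `c` (in opposite directions). -/
def C2UnimodalWith (g : ℝ → ℝ) (c : ℝ) : Prop :=
  c ∈ Set.Ioo (-1 : ℝ) 1 ∧
  Set.MapsTo g (Set.Icc (-1 : ℝ) 1) (Set.Icc (-1 : ℝ) 1) ∧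
  g (-1) ∈ ({-1, 1} : Set ℝ) ∧ g 1 ∈ ({-1, 1} : Set ℝ) ∧
  ContDiffOn ℝ 2 g (Set.Icc (-1 : ℝ) 1) ∧
  (∀ x ∈ Set.Icc (-1 : ℝ) 1, (deriv g x = 0 ↔ x = c)) ∧
  ((StrictMonoOn g (Set.Icc (-1 : ℝ) c) ∧ StrictAntiOn g (Set.Icc c 1)) ∨
    (StrictAntiOn g (Set.Icc (-1 : ℝ) c) ∧ StrictMonoOn g (Set.Icc c 1)))

open Topology

/-- `f` is a unimodal self-map of `[a, b]` with maximum at the turning point `c` and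
`f a = f b = a`. -/
structure Uni (f : ℝ → ℝ) (a b c : ℝ) : Prop where
  lt_left : a < c
  lt_right : c < b
  maps : MapsTo f (Icc a b) (Icc a b)
  cont : ContinuousOn f (Icc a b)
  mono : StrictMonoOn f (Icc a c)
  anti : StrictAntiOn f (Icc c b)
  map_left : f a = a
  map_right : f b = a

/-- Points of `[a, b]` whose orbit hits `c` for the first time at time `n`. -/
def firstHit (f : ℝ → ℝ) (a b c : ℝ) (n : ℕ) : Set ℝ :=
  {x | x ∈ Icc a b ∧ f^[n] x = c ∧ ∀ i < n, f^[i] x ≠ c}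

/-- Number of first hits at time `n`. -/
noncomputable def hits (f : ℝ → ℝ) (a b c : ℝ) (n : ℕ) : ℕ := (firstHit f a b c n).ncard

/-- `e n` is the side on which `f^[n+1]` maps a punctured neighbourhood of `c`. -/
def IsKneading (f : ℝ → ℝ) (c : ℝ) (e : ℕ → ℝ) : Prop :=
  ∀ n, (e n = 1 ∨ e n = -1) ∧ ∀ᶠ x in 𝓝[≠] c, 0 < e n * (c - f^[n + 1] x)

namespace Uni

variable {f : ℝ → ℝ} {a b c : ℝ}

lemma c_mem (h : Uni f a b c) : c ∈ Icc a b := ⟨h.lt_left.le, h.lt_right.le⟩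

lemma iterate_mem (h : Uni f a b c) {x : ℝ} (hx : x ∈ Icc a b) (n : ℕ) : f^[n] x ∈ Icc a b :=
  h.maps.iterate n hx

lemma continuousOn_iterate (h : Uni f a b c) (n : ℕ) : ContinuousOn f^[n] (Icc a b) := by
  induction n with
  | zero => exact continuousOn_id
  | succ n ih => rw [Function.iterate_succ']; exact h.cont.comp ih (h.maps.iterate n)

lemma le_max (h : Uni f a b c) {x : ℝ} (hx : x ∈ Icc a b) : f x ≤ f c := by
  rcases le_total x c with hxc | hxc
  · exact h.mono.monotoneOn ⟨hx.1, hxc⟩ ⟨h.lt_left.le, le_rfl⟩ hxc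
  · exact h.anti.antitoneOn ⟨le_rfl, h.lt_right.le⟩ ⟨hxc, hx.2⟩ hxc

lemma lt_max (h : Uni f a b c) {x : ℝ} (hx : x ∈ Icc a b) (hne : x ≠ c) : f x < f c := by
  rcases lt_or_gt_of_ne hne with hxc | hxc
  · exact h.mono ⟨hx.1, hxc.le⟩ ⟨h.lt_left.le, le_rfl⟩ hxc
  · exact h.anti ⟨le_rfl, h.lt_right.le⟩ ⟨hxc.le, hx.2⟩ hxc

lemma max_mem (h : Uni f a b c) : f c ∈ Ioc a b := by
  refine ⟨?_, (h.maps h.c_mem).2⟩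
  have := h.mono ⟨le_rfl, h.lt_left.le⟩ ⟨h.lt_left.le, le_rfl⟩ h.lt_left
  rwa [h.map_left] at this

lemma injOn_left (h : Uni f a b c) : InjOn f (Icc a c) := h.mono.injOn
lemma injOn_right (h : Uni f a b c) : InjOn f (Icc c b) := h.anti.injOn

lemma firstHit_zero (h : Uni f a b c) : firstHit f a b c 0 = {c} := by
  ext x
  simp only [firstHit, Function.iterate_zero, id, mem_ofPred_eq, not_lt_zero, IsEmpty.forall_iff,
    implies_true, and_true, mem_singleton_iff]
  exact ⟨fun hx => hx.2, fun hx => ⟨hx ▸ h.c_mem, hx⟩⟩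

lemma mem_firstHit_succ (h : Uni f a b c) {x : ℝ} {n : ℕ} :
    x ∈ firstHit f a b c (n + 1) ↔ x ∈ Icc a b ∧ x ≠ c ∧ f x ∈ firstHit f a b c n := by
  constructor
  · rintro ⟨hx, h1, h2⟩
    refine ⟨hx, by simpa using h2 0 (Nat.succ_pos n), h.maps hx, by simpa using h1, ?_⟩
    intro i hi
    simpa using h2 (i + 1) (by omega)
  · rintro ⟨hx, hne, _, h1, h2⟩
    refine ⟨hx, by simpa using h1, ?_⟩
    intro i hi
    cases i with
    | zero => simpa using hne
    | succ i => simpa using h2 i (by omega)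

/-- Points left of `u ≤ c` correspond under `f` to points left of `f u`. -/
lemma image_left (h : Uni f a b c) {u : ℝ} (hu : u ∈ Icc a c) (n : ℕ) :
    f '' (firstHit f a b c (n + 1) ∩ Iio u) = firstHit f a b c n ∩ Iio (f u) := by
  ext y
  constructor
  · rintro ⟨x, ⟨hx, hxu⟩, rfl⟩
    rw [h.mem_firstHit_succ] at hx
    exact ⟨hx.2.2, h.mono ⟨hx.1.1, (mem_Iio.1 hxu).le.trans hu.2⟩ hu hxu⟩
  · rintro ⟨hy, hyu⟩
    have hcont : ContinuousOn f (Icc a u) :=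
      h.cont.mono (Icc_subset_Icc_right (hu.2.trans h.lt_right.le))
    have hyI : y ∈ Ico (f a) (f u) := by rw [h.map_left]; exact ⟨hy.1.1, hyu⟩
    obtain ⟨x, hx, rfl⟩ := intermediate_value_Ico hu.1 hcont hyI
    refine ⟨x, ⟨?_, hx.2⟩, rfl⟩
    rw [h.mem_firstHit_succ]
    exact ⟨⟨hx.1, (hx.2.le.trans hu.2).trans h.lt_right.le⟩, (hx.2.trans_le hu.2).ne, hy⟩

lemma image_right (h : Uni f a b c) {u : ℝ} (hu : u ∈ Icc c b) (n : ℕ) :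
    f '' (firstHit f a b c (n + 1) ∩ Ioi u) = firstHit f a b c n ∩ Iio (f u) := by
  ext y
  constructor
  · rintro ⟨x, ⟨hx, hxu⟩, rfl⟩
    rw [h.mem_firstHit_succ] at hx
    exact ⟨hx.2.2, h.anti hu ⟨hu.1.trans (mem_Ioi.1 hxu).le, hx.1.2⟩ hxu⟩
  · rintro ⟨hy, hyu⟩
    have hcont : ContinuousOn f (Icc u b) :=
      h.cont.mono (Icc_subset_Icc_left (h.lt_left.le.trans hu.1))
    have hyI : y ∈ Ico (f b) (f u) := by rw [h.map_right]; exact ⟨hy.1.1, hyu⟩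
    obtain ⟨x, hx, rfl⟩ := intermediate_value_Ioc' hu.2 hcont hyI
    refine ⟨x, ⟨?_, hx.1⟩, rfl⟩
    rw [h.mem_firstHit_succ]
    exact ⟨⟨(h.lt_left.le.trans hu.1).trans hx.1.le, hx.2⟩, (hu.1.trans_lt hx.1).ne', hy⟩

lemma injOn_firstHit_left (h : Uni f a b c) {u : ℝ} (hu : u ∈ Icc a c) (n : ℕ) :
    InjOn f (firstHit f a b c n ∩ Iio u) := by
  refine h.injOn_left.mono ?_
  rintro x ⟨hx, hxu⟩
  exact ⟨hx.1.1, (mem_Iio.1 hxu).le.trans hu.2⟩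

lemma injOn_firstHit_right (h : Uni f a b c) {u : ℝ} (hu : u ∈ Icc c b) (n : ℕ) :
    InjOn f (firstHit f a b c n ∩ Ioi u) := by
  refine h.injOn_right.mono ?_
  rintro x ⟨hx, hxu⟩
  exact ⟨hu.1.trans (mem_Ioi.1 hxu).le, hx.1.2⟩

lemma c_notMem_firstHit_succ (h : Uni f a b c) (n : ℕ) : c ∉ firstHit f a b c (n + 1) := by
  rw [h.mem_firstHit_succ]; tauto

lemma inter_union_inter {s : Set ℝ} {u : ℝ} (hu : u ∉ s) : s = (s ∩ Iio u) ∪ (s ∩ Ioi u) := by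
  ext x
  constructor
  · intro hx
    rcases lt_trichotomy x u with hl | rfl | hl
    · exact Or.inl ⟨hx, hl⟩
    · exact absurd hx hu
    · exact Or.inr ⟨hx, hl⟩
  · rintro (hx | hx) <;> exact hx.1

lemma finite_firstHit (h : Uni f a b c) (n : ℕ) : (firstHit f a b c n).Finite := by
  induction n with
  | zero => rw [h.firstHit_zero]; exact finite_singleton c
  | succ n ih =>
    rw [inter_union_inter (h.c_notMem_firstHit_succ n)]
    have hl : c ∈ Icc a c := ⟨h.lt_left.le, le_rfl⟩
    have hr : c ∈ Icc c b := ⟨le_rfl, h.lt_right.le⟩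
    refine Set.Finite.union (Set.Finite.of_finite_image ?_ (h.injOn_firstHit_left hl _))
      (Set.Finite.of_finite_image ?_ (h.injOn_firstHit_right hr _))
    · rw [h.image_left hl]; exact ih.inter_of_left _
    · rw [h.image_right hr]; exact ih.inter_of_left _

lemma ncard_left (h : Uni f a b c) {u : ℝ} (hu : u ∈ Icc a c) (n : ℕ) :
    (firstHit f a b c (n + 1) ∩ Iio u).ncard = (firstHit f a b c n ∩ Iio (f u)).ncard := by
  rw [← h.image_left hu, (h.injOn_firstHit_left hu _).ncard_image]

lemma ncard_right (h : Uni f a b c) {u : ℝ} (hu : u ∈ Icc c b) (n : ℕ) :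
    (firstHit f a b c (n + 1) ∩ Ioi u).ncard = (firstHit f a b c n ∩ Iio (f u)).ncard := by
  rw [← h.image_right hu, (h.injOn_firstHit_right hu _).ncard_image]

lemma ncard_add (h : Uni f a b c) {u : ℝ} {n : ℕ} (hu : u ∉ firstHit f a b c n) :
    (firstHit f a b c n ∩ Iio u).ncard + (firstHit f a b c n ∩ Ioi u).ncard = hits f a b c n := by
  rw [hits]
  conv_rhs => rw [inter_union_inter hu]
  refine (ncard_union_eq ?_ ((h.finite_firstHit n).inter_of_left _)
    ((h.finite_firstHit n).inter_of_left _)).symm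
  rw [Set.disjoint_left]
  rintro x ⟨_, hx⟩ ⟨_, hx'⟩
  exact lt_asymm (mem_Iio.1 hx) (mem_Ioi.1 hx')

lemma hits_zero (h : Uni f a b c) : hits f a b c 0 = 1 := by
  rw [hits, h.firstHit_zero, ncard_singleton]

lemma hits_succ (h : Uni f a b c) (n : ℕ) :
    hits f a b c (n + 1) = 2 * (firstHit f a b c n ∩ Iio (f c)).ncard := by
  rw [← h.ncard_add (h.c_notMem_firstHit_succ n), h.ncard_left ⟨h.lt_left.le, le_rfl⟩,
    h.ncard_right ⟨le_rfl, h.lt_right.le⟩]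
  ring

/-- Increments of `hits`. -/
noncomputable def incr (f : ℝ → ℝ) (a b c : ℝ) : ℕ → ℝ
  | 0 => 1
  | n + 1 => (hits f a b c (n + 1) : ℝ) - hits f a b c n

lemma incr_succ (n : ℕ) :
    incr f a b c (n + 1) = (hits f a b c (n + 1) : ℝ) - hits f a b c n := rfl

/-- The excess of first hits on the left of `u` over those on the right is an alternating sum of
increments along the signs of the orbit of `u`. -/
lemma excess_eq (h : Uni f a b c) (s : ℕ → ℝ) (n : ℕ) : ∀ (u : ℝ), u ∈ Icc a b →
    (∀ i ≤ n, (s i = 1 ∨ s i = -1) ∧ 0 < s i * (c - f^[i] u)) →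
    2 * ((firstHit f a b c n ∩ Iio u).ncard : ℝ) - hits f a b c n =
      - ∑ j ∈ Finset.range (n + 1), (∏ i ∈ Finset.range (j + 1), s i) * incr f a b c (n - j) := by
  induction n generalizing s with
  | zero =>
    intro u hu hs
    have h0 := hs 0 le_rfl
    simp only [Function.iterate_zero, id] at h0
    simp only [h.firstHit_zero, h.hits_zero]
    simp only [zero_add, Finset.range_one, Finset.sum_singleton, Finset.prod_singleton, incr]
    rcases h0 with ⟨h1 | h1, h2⟩ <;> rw [h1] at h2 ⊢
    · have : ({c} : Set ℝ) ∩ Iio u = ∅ := by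
        ext x; simp only [mem_inter_iff, mem_singleton_iff, mem_Iio, mem_empty_iff_false,
          iff_false, not_and]; rintro rfl; linarith
      rw [this]; simp
    · have : ({c} : Set ℝ) ∩ Iio u = {c} := by
        ext x; simp only [mem_inter_iff, mem_singleton_iff, mem_Iio, and_iff_left_iff_imp]
        rintro rfl; linarith
      rw [this]; norm_num
  | succ n ih =>
    intro u hu hs
    have h0 := hs 0 (Nat.zero_le _)
    simp only [Function.iterate_zero, id] at h0
    have key := ih (fun i => s (i + 1)) (f u) (h.maps hu) (fun i hi => by
      simpa using hs (i + 1) (by omega))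
    have hsum : ∑ j ∈ Finset.range (n + 1 + 1),
        (∏ i ∈ Finset.range (j + 1), s i) * incr f a b c (n + 1 - j) =
        s 0 * (incr f a b c (n + 1) + ∑ j ∈ Finset.range (n + 1),
        (∏ i ∈ Finset.range (j + 1), s (i + 1)) * incr f a b c (n - j)) := by
      rw [Finset.sum_range_succ', mul_add, Finset.mul_sum, add_comm]
      congr 1
      · simp
      · refine Finset.sum_congr rfl fun j _ => ?_
        rw [Finset.prod_range_succ' _ (j + 1), Nat.add_sub_add_right]
        ring
    rw [hsum, incr_succ]
    rcases h0 with ⟨h1 | h1, h2⟩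
    · rw [h1] at h2 ⊢
      rw [h.ncard_left ⟨hu.1, by linarith⟩]
      linarith
    · rw [h1] at h2 ⊢
      have hne : u ∉ firstHit f a b c (n + 1) := by
        intro hmem
        have := (hs (n + 1) le_rfl).2
        rw [hmem.2.1] at this
        simp at this
      have e1 := h.ncard_add hne
      rw [h.ncard_right ⟨by linarith, hu.2⟩] at e1
      have e2 : ((firstHit f a b c (n + 1) ∩ Iio u).ncard : ℝ) +
        ((firstHit f a b c n ∩ Iio (f u)).ncard : ℝ) = hits f a b c (n + 1) := by exact_mod_cast e1
      linarith

lemma tendsto_left (h : Uni f a b c) : Tendsto f (𝓝[≠] c) (𝓝[<] (f c)) := by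
  have hI : Icc a b ∈ 𝓝 c := Icc_mem_nhds h.lt_left h.lt_right
  refine tendsto_nhdsWithin_iff.2 ⟨?_, ?_⟩
  · exact (h.cont.continuousAt hI).tendsto.mono_left nhdsWithin_le_nhds
  · filter_upwards [self_mem_nhdsWithin, nhdsWithin_le_nhds hI] with x hx hxI
    exact h.lt_max hxI hx

/-- A finite set is eventually avoided on the left of a point. -/
lemma eventually_notMem_of_finite {s : Set ℝ} (hs : s.Finite) (v : ℝ) :
    ∀ᶠ u in 𝓝[<] v, ∀ y ∈ Ico u v, y ∉ s := by
  have : ∀ᶠ u in 𝓝[<] v, ∀ x ∈ s, x < v → x < u := by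
    refine (eventually_all_finite hs).2 fun x _ => ?_
    by_cases hx : x < v
    · filter_upwards [Ioo_mem_nhdsLT hx] with u hu _ using hu.1
    · exact Eventually.of_forall fun _ h => absurd h hx
  filter_upwards [this] with u hu y hy hys
  exact absurd (hu y hys hy.2) (not_lt.2 hy.1)

/-- The set of points hitting `c` before or at time `n` is finite. -/
lemma finite_iterate_eq (h : Uni f a b c) (n : ℕ) : {x | x ∈ Icc a b ∧ f^[n] x = c}.Finite := by
  refine ((finite_le_nat n).biUnion fun i _ => h.finite_firstHit i).subset ?_
  rintro x ⟨hx, hxc⟩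
  classical
  have hex : ∃ i, f^[i] x = c := ⟨n, hxc⟩
  simp only [mem_iUnion]
  refine ⟨Nat.find hex, Nat.find_min' hex hxc, hx, Nat.find_spec hex,
    fun i hi => Nat.find_min hex hi⟩

lemma exists_sign_left (h : Uni f a b c) (n : ℕ) :
    ∃ e : ℝ, (e = 1 ∨ e = -1) ∧ ∀ᶠ u in 𝓝[<] (f c), 0 < e * (c - f^[n] u) := by
  have h1 := eventually_notMem_of_finite (h.finite_iterate_eq n) (f c)
  have h2 : ∀ᶠ u in 𝓝[<] (f c), u ∈ Ioo a (f c) := Ioo_mem_nhdsLT h.max_mem.1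
  obtain ⟨u, hu1, hu2⟩ := (h1.and h2).exists
  have hsub : Ico u (f c) ⊆ Icc a b := fun y hy =>
    ⟨hu2.1.le.trans hy.1, hy.2.le.trans h.max_mem.2⟩
  have hne : ∀ y ∈ Ico u (f c), f^[n] y ≠ c := fun y hy hyc => hu1 y hy ⟨hsub hy, hyc⟩
  have hcont : ContinuousOn f^[n] (Ico u (f c)) := (h.continuousOn_iterate n).mono hsub
  have hconn : IsPreconnected (f^[n] '' Ico u (f c)) := isPreconnected_Ico.image _ hcont
  have hmem : ∀ᶠ y in 𝓝[<] (f c), y ∈ Ico u (f c) := Ico_mem_nhdsLT hu2.2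
  have hu : u ∈ Ico u (f c) := ⟨le_rfl, hu2.2⟩
  have hnc : c ∉ f^[n] '' Ico u (f c) := by
    rintro ⟨y, hy, hyc⟩
    exact hne y hy hyc
  rcases lt_or_gt_of_ne (hne u hu) with hlt | hgt
  · refine ⟨1, Or.inl rfl, ?_⟩
    filter_upwards [hmem] with y hy
    by_contra hcon
    exact hnc (hconn.ordConnected.out (mem_image_of_mem _ hu) (mem_image_of_mem _ hy)
      ⟨hlt.le, by linarith⟩)
  · refine ⟨-1, Or.inr rfl, ?_⟩
    filter_upwards [hmem] with y hy
    by_contra hcon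
    exact hnc (hconn.ordConnected.out (mem_image_of_mem _ hy) (mem_image_of_mem _ hu)
      ⟨by linarith, hgt.le⟩)

lemma exists_kneading (h : Uni f a b c) : ∃ e, IsKneading f c e := by
  choose e he1 he2 using fun n => h.exists_sign_left n
  refine ⟨e, fun n => ⟨he1 n, ?_⟩⟩
  filter_upwards [h.tendsto_left.eventually (he2 n)] with x hx
  simpa using hx

end Uni

lemma IsKneading.eq_one_of_eventually {f : ℝ → ℝ} {c : ℝ} {e : ℕ → ℝ}
    (he : IsKneading f c e) {n : ℕ}
    (h : ∀ᶠ x in 𝓝[≠] c, f^[n + 1] x ≤ c) : e n = 1 := by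
  rcases (he n).1 with h1 | h1
  · exact h1
  · obtain ⟨x, hx1, hx2⟩ := ((he n).2.and h).exists
    rw [h1] at hx1; linarith

lemma IsKneading.eq_neg_one_of_eventually {f : ℝ → ℝ} {c : ℝ} {e : ℕ → ℝ} (he : IsKneading f c e)
    {n : ℕ} (h : ∀ᶠ x in 𝓝[≠] c, c ≤ f^[n + 1] x) : e n = -1 := by
  rcases (he n).1 with h1 | h1
  · obtain ⟨x, hx1, hx2⟩ := ((he n).2.and h).exists
    rw [h1] at hx1; linarith
  · exact h1

namespace Uni

variable {f : ℝ → ℝ} {a b c : ℝ}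

lemma sign_left_of_kneading (h : Uni f a b c) {e : ℕ → ℝ} (he : IsKneading f c e) (n : ℕ) :
    ∀ᶠ u in 𝓝[<] (f c), 0 < e n * (c - f^[n] u) := by
  obtain ⟨e', h1, h2⟩ := h.exists_sign_left n
  have h3 := h.tendsto_left.eventually h2
  have : e n = e' := by
    rcases h1 with rfl | rfl
    · exact he.eq_one_of_eventually (h3.mono fun x hx => by
        rw [Function.iterate_succ_apply]; linarith)
    · exact he.eq_neg_one_of_eventually (h3.mono fun x hx => by
        rw [Function.iterate_succ_apply]; linarith)
  rwa [this]

/-- The Milnor–Thurston identity: the kneading series is inverse to the series of increments. -/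
lemma kneading_identity (h : Uni f a b c) {e : ℕ → ℝ} (he : IsKneading f c e) (n : ℕ) :
    ∑ j ∈ Finset.range (n + 2), (∏ i ∈ Finset.range j, e i) * incr f a b c (n + 1 - j) = 0 := by
  have h1 := eventually_notMem_of_finite (h.finite_firstHit n) (f c)
  have h2 : ∀ᶠ u in 𝓝[<] (f c), u ∈ Ioo a (f c) := Ioo_mem_nhdsLT h.max_mem.1
  have h3 : ∀ᶠ u in 𝓝[<] (f c), ∀ i ∈ Finset.range (n + 1), 0 < e i * (c - f^[i] u) :=
    (eventually_all_finset _).2 fun i _ => h.sign_left_of_kneading he i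
  obtain ⟨u, hu1, hu2, hu3⟩ := (h1.and (h2.and h3)).exists
  have key := h.excess_eq e n u ⟨hu2.1.le, hu2.2.le.trans h.max_mem.2⟩ fun i hi =>
    ⟨(he i).1, hu3 i (Finset.mem_range.2 (by omega))⟩
  have heq : firstHit f a b c n ∩ Iio (f c) = firstHit f a b c n ∩ Iio u := by
    ext x
    constructor
    · rintro ⟨hx, hxc⟩
      refine ⟨hx, ?_⟩
      by_contra hcon
      exact hu1 x ⟨not_lt.1 hcon, hxc⟩ hx
    · rintro ⟨hx, hxu⟩
      exact ⟨hx, (mem_Iio.1 hxu).trans hu2.2⟩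
  have h4 := h.hits_succ n
  rw [heq] at h4
  rw [Finset.sum_range_succ']
  simp only [Finset.range_zero, Finset.prod_empty, one_mul, Nat.sub_zero, Nat.add_sub_add_right]
  have h5 : (hits f a b c (n + 1) : ℝ) = 2 * ((firstHit f a b c n ∩ Iio u).ncard : ℝ) := by
    exact_mod_cast h4
  rw [incr_succ]
  linarith

end Uni

/-- The sum of the complex power series with real coefficients `d`. -/
noncomputable def dser (d : ℕ → ℝ) (z : ℂ) : ℂ := ∑' n, (d n : ℂ) * z ^ n

/-- `a` is nonnegative, `d` is bounded by `2`, and their power series are inverse. -/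
structure Recip (a d : ℕ → ℝ) : Prop where
  nonneg : ∀ n, 0 ≤ a n
  bound : ∀ n, |d n| ≤ 2
  mul : PowerSeries.mk a * PowerSeries.mk d = 1

lemma hasFPowerSeriesOnBall_tsum {b : ℕ → ℂ} {r : NNReal} (hr : 0 < r)
    (hs : Summable fun n => ‖b n‖ * (r : ℝ) ^ n) :
    HasFPowerSeriesOnBall (fun z => ∑' n, b n * z ^ n)
      (FormalMultilinearSeries.ofScalars ℂ b) 0 r where
  r_le := by
    refine FormalMultilinearSeries.le_radius_of_summable_norm _ ?_
    simpa [FormalMultilinearSeries.ofScalars_norm] using hs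
  r_pos := by exact_mod_cast hr
  hasSum := by
    intro y hy
    have hy' : ‖y‖ < r := by
      have := mem_eball_zero_iff.1 hy
      rw [← ofReal_norm, ENNReal.ofReal_lt_coe_iff (norm_nonneg _)] at this
      exact this
    have hsum : Summable fun n => b n * y ^ n := by
      refine Summable.of_norm_bounded hs fun n => ?_
      rw [norm_mul, norm_pow]
      gcongr
    simpa [FormalMultilinearSeries.apply_eq_pow_smul_coeff, FormalMultilinearSeries.coeff_ofScalars,
      mul_comm] using hsum.hasSum

/-- A power series with constant sum `1` near zero is `1`. -/
lemma coeff_eq_of_tsum_eq_one {b : ℕ → ℂ} {r : NNReal} (hr : 0 < r)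
    (hs : Summable fun n => ‖b n‖ * (r : ℝ) ^ n)
    (h1 : ∀ z : ℂ, ‖z‖ < r → ∑' n, b n * z ^ n = 1) (n : ℕ) : b n = if n = 0 then 1 else 0 := by
  have h2 := (hasFPowerSeriesOnBall_tsum hr hs).hasFPowerSeriesAt
  set e : ℕ → ℂ := fun n => if n = 0 then 1 else 0 with he
  have hfin : Summable fun n => ‖e n‖ * (r : ℝ) ^ n :=
    summable_of_ne_finset_zero (s := {0}) fun n hn => by
      have : n ≠ 0 := by simpa using hn
      simp [he, this]
  have h3 := (hasFPowerSeriesOnBall_tsum hr hfin).hasFPowerSeriesAt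
  have heq : (fun z : ℂ => ∑' n, b n * z ^ n) =ᶠ[𝓝 0] fun z => ∑' n, e n * z ^ n := by
    filter_upwards [Metric.ball_mem_nhds (0 : ℂ) (NNReal.coe_pos.2 hr)] with z hz
    rw [h1 z (by simpa using hz), tsum_eq_single 0]
    · simp [he]
    · intro n hn; simp [he, hn]
  have h4 := (h2.congr heq).eq_formalMultilinearSeries h3
  have := congrArg (fun p => FormalMultilinearSeries.coeff p n) h4
  simpa [FormalMultilinearSeries.coeff_ofScalars] using this

section dser

variable {d : ℕ → ℝ}

lemma summable_dser (hd : ∀ n, |d n| ≤ 2) {r : ℝ} (hr0 : 0 ≤ r) (hr : r < 1) :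
    Summable fun n => ‖(d n : ℂ)‖ * r ^ n := by
  refine Summable.of_nonneg_of_le (fun n => by positivity) (fun n => ?_)
    ((summable_geometric_of_lt_one hr0 hr).mul_left 2)
  rw [Complex.norm_real]
  exact mul_le_mul_of_nonneg_right (hd n) (by positivity)

lemma summable_norm_dser (hd : ∀ n, |d n| ≤ 2) {z : ℂ} (hz : ‖z‖ < 1) :
    Summable fun n => ‖(d n : ℂ) * z ^ n‖ := by
  simpa [norm_mul, norm_pow] using summable_dser hd (norm_nonneg z) hz

lemma differentiableOn_dser (hd : ∀ n, |d n| ≤ 2) :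
    DifferentiableOn ℂ (dser d) (Metric.ball 0 1) := by
  intro z hz
  obtain ⟨r, hzr, hr⟩ := exists_between (mem_ball_zero_iff.1 hz)
  have hr0 : 0 < r := (norm_nonneg z).trans_lt hzr
  lift r to NNReal using hr0.le
  have h := hasFPowerSeriesOnBall_tsum (NNReal.coe_pos.1 hr0) (summable_dser hd hr0.le hr)
  have hmem : z ∈ Metric.eball (0 : ℂ) (r : ENNReal) := by
    rw [mem_eball_zero_iff, ← ofReal_norm, ENNReal.ofReal_lt_coe_iff (norm_nonneg _)]
    exact hzr
  exact ((h.differentiableOn z hmem).differentiableAt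
    (Metric.isOpen_eball.mem_nhds hmem)).differentiableWithinAt

end dser

lemma norm_dser_sub_le {d d' : ℕ → ℝ} (hd : ∀ n, |d n| ≤ 2) (hd' : ∀ n, |d' n| ≤ 2) {N : ℕ}
    (h : ∀ n ≤ N, d' n = d n) {z : ℂ} {R : ℝ} (hz : ‖z‖ ≤ R) (hR : R < 1) :
    ‖dser d' z - dser d z‖ ≤ 4 / (1 - R) * R ^ N := by
  have hR0 : 0 ≤ R := (norm_nonneg z).trans hz
  have hz1 : ‖z‖ < 1 := hz.trans_lt hR
  have hs := summable_norm_dser hd hz1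
  have hs' := summable_norm_dser hd' hz1
  rw [dser, dser, ← hs'.of_norm.tsum_sub hs.of_norm]
  have hsum : HasSum (fun n => 4 * R ^ N * R ^ n) (4 / (1 - R) * R ^ N) := by
    have := (hasSum_geometric_of_lt_one hR0 hR).mul_left (4 * R ^ N)
    rwa [show 4 / (1 - R) * R ^ N = 4 * R ^ N * (1 - R)⁻¹ by rw [div_eq_mul_inv]; ring]
  have hshift : ∑' n, ((d' n : ℂ) * z ^ n - (d n : ℂ) * z ^ n) =
      ∑' n, ((d' (n + N) : ℂ) * z ^ (n + N) - (d (n + N) : ℂ) * z ^ (n + N)) := by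
    rw [← (hs'.of_norm.sub hs.of_norm).sum_add_tsum_nat_add N, Finset.sum_eq_zero, zero_add]
    intro i hi
    rw [h i (Finset.mem_range.1 hi).le, sub_self]
  rw [hshift]
  refine tsum_of_norm_bounded hsum fun n => ?_
  rw [← sub_mul, norm_mul, norm_pow, ← Complex.ofReal_sub, Complex.norm_real, mul_assoc, ← pow_add,
    add_comm N n]
  have : ‖d' (n + N) - d (n + N)‖ ≤ 4 := by
    rw [Real.norm_eq_abs]
    exact (abs_sub _ _).trans (by linarith [hd (n + N), hd' (n + N)])
  gcongr

namespace Recip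

variable {a d : ℕ → ℝ}

lemma sum_antidiagonal (h : Recip a d) (n : ℕ) :
    ∑ kl ∈ Finset.HasAntidiagonal.antidiagonal n, a kl.1 * d kl.2 = if n = 0 then 1 else 0 := by
  have := congrArg (PowerSeries.coeff n) h.mul
  simpa [PowerSeries.coeff_mul, PowerSeries.coeff_one] using this

lemma dser_mul (h : Recip a d) {z : ℂ} (hz : ‖z‖ < 1) (hs : Summable fun n => a n * ‖z‖ ^ n) :
    dser a z * dser d z = 1 := by
  have hs' : Summable fun n => ‖(a n : ℂ) * z ^ n‖ := by
    refine hs.congr fun n => ?_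
    rw [norm_mul, norm_pow, Complex.norm_real, Real.norm_eq_abs, abs_of_nonneg (h.nonneg n)]
  rw [dser, dser, tsum_mul_tsum_eq_tsum_sum_antidiagonal_of_summable_norm hs'
    (summable_norm_dser h.bound hz)]
  have : ∀ n, ∑ kl ∈ Finset.HasAntidiagonal.antidiagonal n,
      (a kl.1 : ℂ) * z ^ kl.1 * ((d kl.2 : ℂ) * z ^ kl.2) =
      if n = 0 then 1 else 0 := by
    intro n
    have h1 : ∑ kl ∈ Finset.HasAntidiagonal.antidiagonal n,
        (a kl.1 : ℂ) * z ^ kl.1 * ((d kl.2 : ℂ) * z ^ kl.2) =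
        ((∑ kl ∈ Finset.HasAntidiagonal.antidiagonal n, a kl.1 * d kl.2 : ℝ) : ℂ) * z ^ n := by
      rw [Complex.ofReal_sum, Finset.sum_mul]
      refine Finset.sum_congr rfl fun kl hkl => ?_
      rw [← Finset.HasAntidiagonal.mem_antidiagonal.1 hkl, pow_add, Complex.ofReal_mul]
      ring
    rw [h1, h.sum_antidiagonal]
    split_ifs with hn
    · simp [hn]
    · simp
  simp_rw [this]
  exact tsum_ite_eq 0 _

lemma dser_ne_zero (h : Recip a d) {z : ℂ} (hz : ‖z‖ < 1) (hs : Summable fun n => a n * ‖z‖ ^ n) :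
    dser d z ≠ 0 := right_ne_zero_of_mul_eq_one (h.dser_mul hz hs)

lemma summable_of_dser_ne_zero (h : Recip a d) {R : ℝ} (hR : R ≤ 1)
    (hne : ∀ z : ℂ, ‖z‖ < R → dser d z ≠ 0) {x : ℝ} (hx0 : 0 ≤ x) (hx : x < R) :
    Summable fun n => a n * x ^ n := by
  have hdiff : DifferentiableOn ℂ (fun z => (dser d z)⁻¹) (Metric.ball 0 R) :=
    ((differentiableOn_dser h.bound).mono (Metric.ball_subset_ball hR)).inv
      fun z hz => hne z (mem_ball_zero_iff.1 hz)
  set b : ℕ → ℂ := fun n => (n.factorial : ℂ)⁻¹ * iteratedDeriv n (fun z => (dser d z)⁻¹) 0 with hb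
  have hsum : ∀ z : ℂ, ‖z‖ < R → HasSum (fun n => b n * z ^ n) (dser d z)⁻¹ := by
    intro z hz
    have := Complex.hasSum_taylorSeries_on_ball hdiff (mem_ball_zero_iff.2 hz)
    have heq : (fun n => b n * z ^ n) = fun n : ℕ => (n.factorial : ℂ)⁻¹ •
        (z - 0) ^ n • iteratedDeriv n (fun z => (dser d z)⁻¹) 0 := by
      funext n
      simp only [hb, sub_zero, smul_eq_mul]
      ring
    rw [heq]
    exact this
  have hnorm : ∀ x : ℝ, 0 ≤ x → x < R → Summable fun n => ‖b n‖ * x ^ n := by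
    intro x hx0 hx
    have := (hsum (x : ℂ) (by rw [Complex.norm_real, Real.norm_eq_abs, abs_of_nonneg hx0]; exact hx)
      ).summable.norm
    refine this.congr fun n => ?_
    rw [norm_mul, norm_pow, Complex.norm_real, Real.norm_eq_abs, abs_of_nonneg hx0]
  have hR0 : 0 < R := hx0.trans_lt hx
  set dc : ℕ → ℂ := fun n => (d n : ℂ) with hdc
  have hbd : PowerSeries.mk b * PowerSeries.mk dc = 1 := by
    have hr1 : R / 2 < 1 := by linarith
    have hr0 : 0 ≤ R / 2 := by linarith
    have hmulpow : ∀ (z : ℂ) (n : ℕ), ∑ kl ∈ Finset.HasAntidiagonal.antidiagonal n,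
        b kl.1 * z ^ kl.1 * (dc kl.2 * z ^ kl.2) =
        (∑ kl ∈ Finset.HasAntidiagonal.antidiagonal n, b kl.1 * dc kl.2) * z ^ n := by
      intro z n
      rw [Finset.sum_mul]
      refine Finset.sum_congr rfl fun kl hkl => ?_
      rw [← Finset.HasAntidiagonal.mem_antidiagonal.1 hkl, pow_add]
      ring
    have key := coeff_eq_of_tsum_eq_one
      (b := fun n => ∑ kl ∈ Finset.HasAntidiagonal.antidiagonal n, b kl.1 * dc kl.2)
      (r := ⟨R / 2, hr0⟩) (by exact_mod_cast (half_pos hR0)) ?_ ?_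
    · ext n
      rw [PowerSeries.coeff_mul, PowerSeries.coeff_one]
      simpa using key n
    · have h1 := summable_norm_sum_mul_antidiagonal_of_summable_norm
        (f := fun n => b n * ((R / 2 : ℝ) : ℂ) ^ n) (g := fun n => dc n * ((R / 2 : ℝ) : ℂ) ^ n)
        (by simpa [abs_of_nonneg hR0.le] using hnorm (R / 2) hr0 (by linarith))
        (by simpa [abs_of_nonneg hR0.le, hdc] using summable_dser h.bound hr0 hr1)
      refine h1.congr fun n => ?_
      rw [hmulpow, norm_mul, norm_pow, Complex.norm_real, Real.norm_eq_abs, abs_of_nonneg hr0]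
      rfl
    · intro z hz
      replace hz : ‖z‖ < R / 2 := hz
      have hzR : ‖z‖ < R := by linarith
      simp_rw [← hmulpow]
      rw [← tsum_mul_tsum_eq_tsum_sum_antidiagonal_of_summable_norm (hsum z hzR).summable.norm
        (summable_norm_dser h.bound (by linarith)), (hsum z hzR).tsum_eq]
      exact inv_mul_cancel₀ (hne z hzR)
  have hac : PowerSeries.mk (fun n => (a n : ℂ)) * PowerSeries.mk dc = 1 := by
    ext n
    have := congrArg (fun x : ℝ => (x : ℂ)) (h.sum_antidiagonal n)
    rw [PowerSeries.coeff_mul, PowerSeries.coeff_one]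
    simp only [PowerSeries.coeff_mk, hdc]
    simpa [Complex.ofReal_sum, apply_ite] using this
  have hab : PowerSeries.mk (fun n => (a n : ℂ)) = PowerSeries.mk b := by
    calc PowerSeries.mk (fun n => (a n : ℂ))
        = PowerSeries.mk b * PowerSeries.mk dc * PowerSeries.mk (fun n => (a n : ℂ)) := by
          rw [hbd, one_mul]
      _ = PowerSeries.mk b * (PowerSeries.mk (fun n => (a n : ℂ)) * PowerSeries.mk dc) := by ring
      _ = PowerSeries.mk b := by rw [hac, mul_one]
  refine (hnorm x hx0 hx).congr fun n => ?_
  have := congrArg (PowerSeries.coeff n) hab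
  simp only [PowerSeries.coeff_mk] at this
  rw [← this, Complex.norm_real, Real.norm_eq_abs, abs_of_nonneg (h.nonneg n)]

lemma summable_mono (h : Recip a d) {x y : ℝ} (hx : 0 ≤ x) (hxy : x ≤ y)
    (hs : Summable fun n => a n * y ^ n) : Summable fun n => a n * x ^ n := by
  refine Summable.of_nonneg_of_le (fun n => mul_nonneg (h.nonneg n) (by positivity))
    (fun n => ?_) hs
  have := h.nonneg n
  gcongr

lemma norm_dser_le (h : Recip a d) {z : ℂ} {x : ℝ} (hz : ‖z‖ ≤ x)
    (hs : Summable fun n => a n * x ^ n) : ‖dser a z‖ ≤ ∑' n, a n * x ^ n := by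
  refine tsum_of_norm_bounded hs.hasSum fun n => ?_
  rw [norm_mul, norm_pow, Complex.norm_real, Real.norm_eq_abs, abs_of_nonneg (h.nonneg n)]
  have := h.nonneg n
  gcongr

lemma dser_ofReal (a : ℕ → ℝ) (x : ℝ) : dser a x = ((∑' n, a n * x ^ n : ℝ) : ℂ) := by
  rw [dser, Complex.ofReal_tsum]
  simp

/-- On a disc where `∑ a_n z^n` converges, `|∑ d_n z^n|` is minimal on the positive axis. -/
lemma norm_dser_ofReal_le (h : Recip a d) {z : ℂ} {x : ℝ} (hz : ‖z‖ ≤ x) (hx : x < 1)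
    (hs : Summable fun n => a n * x ^ n) : ‖dser d x‖ ≤ ‖dser d z‖ := by
  have hx0 : 0 ≤ x := (norm_nonneg z).trans hz
  have hnx : ‖(x : ℂ)‖ = x := by rw [Complex.norm_real, Real.norm_eq_abs, abs_of_nonneg hx0]
  have h1 := congrArg norm (h.dser_mul (z := x) (by rwa [hnx]) (by rwa [hnx]))
  have h2 := congrArg norm (h.dser_mul (z := z) (hz.trans_lt hx)
    (h.summable_mono (norm_nonneg z) hz hs))
  rw [norm_mul, norm_one] at h1 h2
  have h3 : ‖dser a z‖ ≤ ‖dser a x‖ := by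
    rw [dser_ofReal, Complex.norm_real, Real.norm_eq_abs, abs_of_nonneg
      (tsum_nonneg fun n => mul_nonneg (h.nonneg n) (by positivity))]
    exact h.norm_dser_le hz hs
  have h4 : 0 < ‖dser a z‖ := by
    rcases (norm_nonneg (dser a z)).eq_or_lt with h0 | h0
    · rw [← h0] at h2; simp at h2
    · exact h0
  by_contra! hlt
  have : ‖dser a z‖ * ‖dser d z‖ < ‖dser a x‖ * ‖dser d x‖ :=
    mul_lt_mul' h3 hlt (norm_nonneg _) (h4.trans_le h3)
  linarith

/-- The radius of convergence of `∑ a_n z^n` is a zero of `∑ d_n z^n`. -/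
lemma dser_eq_zero (h : Recip a d) {s : ℝ} (hs0 : 0 < s) (hs1 : s < 1)
    (hlt : ∀ x, 0 ≤ x → x < s → Summable fun n => a n * x ^ n)
    (hgt : ∀ x, s < x → x < 1 → ¬ Summable fun n => a n * x ^ n) : dser d s = 0 := by
  have hns : ‖(s : ℂ)‖ = s := by rw [Complex.norm_real, Real.norm_eq_abs, abs_of_nonneg hs0.le]
  have hopen : IsOpen {z ∈ Metric.ball (0 : ℂ) 1 | dser d z ≠ 0} := by
    have := (differentiableOn_dser h.bound).continuousOn.isOpen_inter_preimage Metric.isOpen_ball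
      (isOpen_compl_singleton (x := (0 : ℂ)))
    exact this
  have hz : ∃ z : ℂ, ‖z‖ ≤ s ∧ dser d z = 0 := by
    by_contra! hcon
    have hsub : Metric.closedBall (0 : ℂ) s ⊆ {z ∈ Metric.ball (0 : ℂ) 1 | dser d z ≠ 0} := by
      intro z hz
      have hz' := mem_closedBall_zero_iff.1 hz
      exact ⟨mem_ball_zero_iff.2 (hz'.trans_lt hs1), hcon z hz'⟩
    obtain ⟨δ, hδ, hδs⟩ := (isCompact_closedBall (0 : ℂ) s).exists_thickening_subset_open hopen hsub
    rw [thickening_closedBall hδ hs0.le] at hδs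
    obtain ⟨x, hx1, hx2⟩ := exists_between (lt_min (lt_add_of_pos_left s hδ) hs1)
    refine hgt x hx1 (hx2.trans_le (min_le_right _ _)) ?_
    refine h.summable_of_dser_ne_zero (R := min (δ + s) 1) (min_le_right _ _) ?_
      (hs0.trans hx1).le hx2
    intro z hz
    exact (hδs (mem_ball_zero_iff.2 (hz.trans_le (min_le_left _ _)))).2
  obtain ⟨z, hzs, hz0⟩ := hz
  have hzs' : ‖z‖ = s := by
    refine le_antisymm hzs ?_
    by_contra! hcon
    exact h.dser_ne_zero (hzs.trans_lt hs1) (hlt _ (norm_nonneg z) hcon) hz0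
  have hcont : ∀ w : ℂ, ‖w‖ = s →
      Tendsto (fun r : ℝ => ‖dser d (r * w)‖) (𝓝[<] 1) (𝓝 ‖dser d w‖) := by
    intro w hw
    have h1 : ContinuousAt (dser d) w := ((differentiableOn_dser h.bound).differentiableAt
      (Metric.isOpen_ball.mem_nhds (mem_ball_zero_iff.2 (hw.trans_lt hs1)))).continuousAt
    have h2 : Tendsto (fun r : ℝ => (r : ℂ) * w) (𝓝 1) (𝓝 w) := by
      have : Continuous fun r : ℝ => (r : ℂ) * w := by fun_prop
      simpa using this.tendsto 1
    exact (h1.norm.tendsto.comp h2).mono_left nhdsWithin_le_nhds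
  have hle : ‖dser d s‖ ≤ ‖dser d z‖ := by
    refine le_of_tendsto_of_tendsto (hcont s hns) (hcont z hzs') ?_
    filter_upwards [Ioo_mem_nhdsLT (zero_lt_one' ℝ)] with r hr
    have hrs : r * s < s := mul_lt_of_lt_one_left hs0 hr.2
    have := h.norm_dser_ofReal_le (z := r * z) (x := r * s) (by
      rw [norm_mul, hzs', Complex.norm_real, Real.norm_eq_abs, abs_of_nonneg hr.1.le])
      (hrs.trans hs1) (hlt _ (mul_nonneg hr.1.le hs0.le) hrs)
    simpa using this
  rw [hz0, norm_zero] at hle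
  exact norm_le_zero_iff.1 hle

lemma exists_lower_bound (h : Recip a d) {s : ℝ} (hs0 : 0 < s) (hs1 : s < 1)
    (hlt : ∀ x, 0 ≤ x → x < s → Summable fun n => a n * x ^ n) :
    ∃ κ > 0, ∃ δ > 0, ∃ m : ℕ, ∀ z : ℂ, ‖z - s‖ ≤ δ → κ * ‖z - s‖ ^ m ≤ ‖dser d z‖ := by
  have hns : ‖(s : ℂ)‖ = s := by rw [Complex.norm_real, Real.norm_eq_abs, abs_of_nonneg hs0.le]
  have han : AnalyticAt ℂ (dser d) s := (differentiableOn_dser h.bound).analyticAt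
    (Metric.isOpen_ball.mem_nhds (mem_ball_zero_iff.2 (hns.trans_lt hs1)))
  have hnz : ¬ ∀ᶠ z in 𝓝 (s : ℂ), dser d z = 0 := by
    intro hev
    have hc : Tendsto (fun x : ℝ => (x : ℂ)) (𝓝[<] s) (𝓝 (s : ℂ)) :=
      (Complex.continuous_ofReal.tendsto s).mono_left nhdsWithin_le_nhds
    obtain ⟨x, hx1, hx2⟩ := ((hc.eventually hev).and (Ioo_mem_nhdsLT hs0)).exists
    have hnx : ‖(x : ℂ)‖ = x := by rw [Complex.norm_real, Real.norm_eq_abs, abs_of_nonneg hx2.1.le]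
    exact h.dser_ne_zero (by rw [hnx]; exact hx2.2.trans hs1)
      (by rw [hnx]; exact hlt x hx2.1.le hx2.2) hx1
  obtain ⟨m, g, hg, hg0, hfg⟩ := han.exists_eventuallyEq_pow_smul_nonzero_iff.2 hnz
  have hpos : 0 < ‖g s‖ := norm_pos_iff.2 hg0
  have hgn : ∀ᶠ z in 𝓝 (s : ℂ), ‖g s‖ / 2 < ‖g z‖ :=
    hg.continuousAt.norm.eventually (lt_mem_nhds (half_lt_self hpos))
  obtain ⟨δ, hδ, hb⟩ := Metric.nhds_basis_closedBall.eventually_iff.1 (hfg.and hgn)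
  refine ⟨‖g s‖ / 2, half_pos hpos, δ, hδ, m, fun z hz => ?_⟩
  obtain ⟨h1, h2⟩ := hb (mem_closedBall_iff_norm.2 hz)
  rw [h1, norm_smul, norm_pow, mul_comm]
  gcongr

/-- Stability of the radius of convergence under a change of the tail of `d`. -/
lemma exists_radius_stable (h : Recip a d) {s : ℝ} (hs0 : 0 < s) (hs1 : s < 1)
    (hlt : ∀ x, 0 ≤ x → x < s → Summable fun n => a n * x ^ n)
    (hgt : ∀ x, s < x → x < 1 → ¬ Summable fun n => a n * x ^ n) :
    ∃ C > 0, ∃ ρ : ℝ, 0 < ρ ∧ ρ < 1 ∧ ∀ (N : ℕ) (a' d' : ℕ → ℝ), Recip a' d' →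
      (∀ n ≤ N, d' n = d n) →
      (∀ x, 0 ≤ x → x < s - C * ρ ^ N → Summable fun n => a' n * x ^ n) ∧
      (∀ x, s + C * ρ ^ N < x → x < 1 → ¬ Summable fun n => a' n * x ^ n) := by
  obtain ⟨κ, hκ, δ₀, hδ₀, m, hlow⟩ := h.exists_lower_bound hs0 hs1 hlt
  have hz := h.dser_eq_zero hs0 hs1 hlt hgt
  obtain ⟨R, hR⟩ : ∃ R, R = (1 + s) / 2 := ⟨_, rfl⟩
  have hsR : s < R := by linarith
  have hR1 : R < 1 := by linarith
  have hR0 : 0 < R := by linarith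
  obtain ⟨δ, hδ⟩ : ∃ δ, δ = min (min δ₀ (R - s)) 1 := ⟨_, rfl⟩
  have hδ0 : 0 < δ := by rw [hδ]; exact lt_min (lt_min hδ₀ (by linarith)) one_pos
  have hδδ : δ ≤ δ₀ := by rw [hδ]; exact (min_le_left _ _).trans (min_le_left _ _)
  have hδR : δ ≤ R - s := by rw [hδ]; exact (min_le_left _ _).trans (min_le_right _ _)
  have hδ1 : δ ≤ 1 := by rw [hδ]; exact min_le_right _ _
  obtain ⟨K, hK⟩ : ∃ K, K = 4 / (1 - R) := ⟨_, rfl⟩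
  have hK0 : 0 < K := by rw [hK]; exact div_pos (by norm_num) (by linarith)
  obtain ⟨C, hC⟩ : ∃ C, C = 3 * K / κ + 1 := ⟨_, rfl⟩
  have hC1 : 1 ≤ C := by rw [hC]; have := div_pos (mul_pos three_pos hK0) hκ; linarith
  obtain ⟨ρ, hρ⟩ : ∃ ρ, ρ = 1 - (1 - R) / (m + 1) := ⟨_, rfl⟩
  have hm1 : (0 : ℝ) < m + 1 := by positivity
  have hq0 : 0 < (1 - R) / (m + 1) := div_pos (by linarith) hm1
  have hq1 : (1 - R) / (m + 1) < 1 := by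
    rw [div_lt_one hm1]; have : (0 : ℝ) ≤ m := by positivity
    linarith
  have hρ0 : 0 < ρ := by linarith
  have hρ1 : ρ < 1 := by linarith
  have hρR : R ≤ ρ ^ (m + 1) := by
    have := one_add_mul_le_pow (a := -((1 - R) / (m + 1))) (by linarith) (m + 1)
    rw [show 1 + -((1 - R) / ((m : ℝ) + 1)) = ρ by rw [hρ]; ring] at this
    refine le_trans (le_of_eq ?_) this
    push_cast
    field_simp
    ring
  have main : ∀ (N : ℕ) (a' d' : ℕ → ℝ), Recip a' d' → (∀ n ≤ N, d' n = d n) → C * ρ ^ N ≤ δ →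
      (∀ x, 0 ≤ x → x < s - C * ρ ^ N → Summable fun n => a' n * x ^ n) ∧
      (∀ x, s + C * ρ ^ N < x → x < 1 → ¬ Summable fun n => a' n * x ^ n) := by
    intro N a' d' h' hagree hN
    obtain ⟨η, hη⟩ : ∃ η, η = C * ρ ^ N := ⟨_, rfl⟩
    rw [← hη] at hN ⊢
    have hη0 : 0 < η := by rw [hη]; positivity
    have hη1 : η ≤ 1 := hN.trans hδ1
    have hbig : 3 * (K * R ^ N) ≤ κ * η ^ m := by
      have h1 : κ * η ^ (m + 1) ≤ κ * η ^ m :=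
        mul_le_mul_of_nonneg_left (pow_le_pow_of_le_one hη0.le hη1 (Nat.le_succ m)) hκ.le
      have h2 : C * R ^ N ≤ η ^ (m + 1) := by
        rw [hη, mul_pow, ← pow_mul, mul_comm N, pow_mul]
        refine mul_le_mul (le_self_pow₀ hC1 (Nat.succ_ne_zero m)) ?_ (by positivity) (by positivity)
        exact pow_le_pow_left₀ hR0.le hρR N
      have h3 : 3 * K ≤ κ * C := by
        rw [hC]; field_simp; linarith
      calc 3 * (K * R ^ N) = 3 * K * R ^ N := by ring
        _ ≤ κ * C * R ^ N := by gcongr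
        _ = κ * (C * R ^ N) := by ring
        _ ≤ κ * η ^ (m + 1) := by gcongr
        _ ≤ _ := h1
    have hKR : 0 < K * R ^ N := by positivity
    have hdiff : ∀ z : ℂ, ‖z‖ ≤ R → ‖dser d' z - dser d z‖ ≤ K * R ^ N := fun z hz => by
      rw [hK]; exact norm_dser_sub_le h.bound h'.bound hagree hz hR1
    constructor
    · intro x hx0 hx
      refine h'.summable_of_dser_ne_zero (R := s - η) (by linarith) ?_ hx0 hx
      intro z hz h0
      have hy0 : 0 ≤ s - η := (norm_nonneg z).trans hz.le
      have h1 := h.norm_dser_ofReal_le hz.le (by linarith) (hlt (s - η) hy0 (by linarith))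
      have hsub : ‖((s - η : ℝ) : ℂ) - s‖ = η := by
        rw [← Complex.ofReal_sub, Complex.norm_real, Real.norm_eq_abs, sub_sub_cancel_left, abs_neg,
          abs_of_pos hη0]
      have h2 := hlow ((s - η : ℝ) : ℂ) (by rw [hsub]; linarith)
      rw [hsub] at h2
      have h3 := hdiff z (by linarith)
      rw [h0, zero_sub, norm_neg] at h3
      linarith
    · intro x hx hx1 hsum
      have hx0 : 0 < x := by linarith
      have hne : ∀ z ∈ Metric.closedBall (s : ℂ) η, dser d' z ≠ 0 := by
        intro z hz
        have hzn : ‖z‖ ≤ s + η := by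
          have h1 := norm_add_le (z - s) (s : ℂ)
          rw [sub_add_cancel, Complex.norm_real, Real.norm_eq_abs, abs_of_pos hs0] at h1
          have h2 := mem_closedBall_iff_norm.1 hz
          linarith
        exact h'.dser_ne_zero (by linarith) (h'.summable_mono (norm_nonneg z) (by linarith) hsum)
      have hsubset : Metric.closedBall (s : ℂ) η ⊆ Metric.ball 0 1 := by
        intro z hz
        have h1 := norm_add_le (z - s) (s : ℂ)
        rw [sub_add_cancel, Complex.norm_real, Real.norm_eq_abs, abs_of_pos hs0] at h1
        have h2 := mem_closedBall_iff_norm.1 hz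
        rw [mem_ball_zero_iff]
        linarith
      have hdcl : DiffContOnCl ℂ (fun z => (dser d' z)⁻¹) (Metric.ball (s : ℂ) η) := by
        refine DifferentiableOn.diffContOnCl ?_
        rw [closure_ball _ hη0.ne']
        exact ((differentiableOn_dser h'.bound).mono hsubset).inv hne
      have hmax := Complex.norm_le_of_forall_mem_frontier_norm_le Metric.isBounded_ball hdcl
        (C := (2 * (K * R ^ N))⁻¹) (z := s) ?_ (subset_closure (Metric.mem_ball_self hη0))
      · have h3 := hdiff s (by
          rw [Complex.norm_real, Real.norm_eq_abs, abs_of_pos hs0]; exact hsR.le)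
        rw [hz, sub_zero] at h3
        rw [norm_inv, inv_le_inv₀ (norm_pos_iff.2 (hne _ (Metric.mem_closedBall_self hη0.le)))
          (by positivity)] at hmax
        linarith
      · intro z hz
        rw [frontier_ball _ hη0.ne', mem_sphere_iff_norm] at hz
        have hzn : ‖z‖ ≤ R := by
          have h1 := norm_add_le (z - s) (s : ℂ)
          rw [sub_add_cancel, Complex.norm_real, Real.norm_eq_abs, abs_of_pos hs0] at h1
          linarith
        have h2 := hlow z (by rw [hz]; linarith)
        rw [hz] at h2
        have h3 := hdiff z hzn
        have h4 := norm_sub_norm_le (dser d z) (dser d' z)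
        rw [norm_sub_rev] at h4
        rw [norm_inv]
        refine inv_anti₀ (by positivity) (by linarith)
  refine ⟨C / δ, by positivity, ρ, hρ0, hρ1, fun N a' d' h' hagree => ?_⟩
  rcases le_or_gt (C * ρ ^ N) δ with hN | hN
  · have hle : C * ρ ^ N ≤ C / δ * ρ ^ N := by
      have : C ≤ C / δ := le_div_self (by linarith) hδ0 hδ1
      gcongr
    obtain ⟨h1, h2⟩ := main N a' d' h' hagree hN
    exact ⟨fun x hx0 hx => h1 x hx0 (by linarith), fun x hx hx1 => h2 x (by linarith) hx1⟩
  · have hone : 1 < C / δ * ρ ^ N := by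
      rw [div_mul_eq_mul_div, one_lt_div hδ0]; exact hN
    exact ⟨fun x hx0 hx => by linarith, fun x hx hx1 => by linarith⟩

end Recip

/-- Coefficients of `(1 - z) ∑ ε_k z^k`, where `ε_k = e 0 ⋯ e (k-1)`. -/
noncomputable def kneadCoeff (e : ℕ → ℝ) : ℕ → ℝ
  | 0 => 1
  | n + 1 => (∏ i ∈ Finset.range (n + 1), e i) - ∏ i ∈ Finset.range n, e i

lemma kneadCoeff_congr {e e' : ℕ → ℝ} {N : ℕ} (h : ∀ i < N, e' i = e i) :
    ∀ n ≤ N, kneadCoeff e' n = kneadCoeff e n := by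
  intro n hn
  cases n with
  | zero => rfl
  | succ n =>
    simp only [kneadCoeff]
    congr 1 <;> exact Finset.prod_congr rfl fun i hi => h i (by
      have := Finset.mem_range.1 hi; omega)

lemma mk_kneadCoeff (e : ℕ → ℝ) : PowerSeries.mk (kneadCoeff e) =
    (1 - PowerSeries.X) * PowerSeries.mk fun n => ∏ i ∈ Finset.range n, e i := by
  ext n
  rw [sub_mul, one_mul, map_sub]
  cases n with
  | zero => simp [kneadCoeff]
  | succ n => simp [kneadCoeff, PowerSeries.coeff_succ_X_mul]

lemma abs_prod_sign {e : ℕ → ℝ} (he : ∀ n, e n = 1 ∨ e n = -1) (n : ℕ) :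
    |∏ i ∈ Finset.range n, e i| = 1 := by
  rw [Finset.abs_prod]
  exact Finset.prod_eq_one fun i _ => by rcases he i with h | h <;> simp [h]

lemma Uni.recip {f : ℝ → ℝ} {a b c : ℝ} (h : Uni f a b c) {e : ℕ → ℝ} (he : IsKneading f c e) :
    Recip (fun n => (hits f a b c n : ℝ)) (kneadCoeff e) where
  nonneg n := Nat.cast_nonneg _
  bound n := by
    have h1 := abs_prod_sign fun n => (he n).1
    cases n with
    | zero => simp [kneadCoeff]
    | succ n =>
      simp only [kneadCoeff]
      exact (abs_sub _ _).trans (by rw [h1, h1]; norm_num)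
  mul := by
    have h1 : (1 - PowerSeries.X) * PowerSeries.mk (fun n => (hits f a b c n : ℝ)) =
        PowerSeries.mk (Uni.incr f a b c) := by
      ext n
      rw [sub_mul, one_mul, map_sub]
      cases n with
      | zero => simp [Uni.incr, h.hits_zero]
      | succ n => simp [Uni.incr, PowerSeries.coeff_succ_X_mul]
    have h2 : PowerSeries.mk (fun n => ∏ i ∈ Finset.range n, e i) *
        PowerSeries.mk (Uni.incr f a b c) = 1 := by
      ext n
      rw [PowerSeries.coeff_mul, PowerSeries.coeff_one]
      simp only [PowerSeries.coeff_mk]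
      rw [Finset.Nat.sum_antidiagonal_eq_sum_range_succ
        (f := fun i j => (∏ k ∈ Finset.range i, e k) * Uni.incr f a b c j)]
      cases n with
      | zero => simp [Uni.incr]
      | succ n => simpa using h.kneading_identity he n
    rw [mk_kneadCoeff, mul_left_comm, ← mul_assoc, h1, mul_comm, h2]

section CoverEntropy

variable {g : ℝ → ℝ} {F : Set ℝ}

lemma coverEntropy_le_of_forall_cover {r : ℝ}
    (h : ∀ ε > 0, ∀ᶠ n : ℕ in atTop, ∃ s : Finset ℝ, (s.card : ℝ) ≤ Real.exp (r * n) ∧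
      ∀ x ∈ F, ∃ y ∈ s, ∀ k < n, |g^[k] x - g^[k] y| < ε) :
    Dynamics.coverEntropy g F ≤ (r : EReal) := by
  rw [Dynamics.coverEntropy_eq_iSup_basis Metric.uniformity_basis_dist]
  refine iSup₂_le fun ε hε => ?_
  refine _root_.Eventually.expGrowthSup_le ?_
  filter_upwards [h ε hε] with n ⟨s, hs, hcov⟩
  have hc : Dynamics.IsDynCoverOf g F {p : ℝ × ℝ | dist p.1 p.2 < ε} n s := by
    intro x hx
    obtain ⟨y, hy, hxy⟩ := hcov x hx
    refine ⟨y, hy, ?_⟩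
    exact Dynamics.mem_dynEntourage.2 fun k hk => by
      simpa [Real.dist_eq] using hxy k hk
  have h1 := ENat.toENNReal_mono hc.coverMincard_le_card
  refine h1.trans ?_
  have h2 : ((s.card : ℕ∞) : ENNReal) = ENNReal.ofReal (s.card : ℝ) := by simp
  rw [h2, show ((r : EReal) * (n : EReal)) = ((r * n : ℝ) : EReal) by push_cast; rfl,
    EReal.exp_coe]
  exact ENNReal.ofReal_le_ofReal hs

lemma eventually_exists_cover {r : ℝ}
    (h : Dynamics.coverEntropy g F < (r : EReal)) {ε : ℝ} (hε : 0 < ε) :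
    ∀ᶠ n : ℕ in atTop, ∃ s : Finset ℝ, (s.card : ℝ) ≤ Real.exp (r * n) ∧
      ∀ x ∈ F, ∃ y ∈ s, ∀ k < n, |g^[k] x - g^[k] y| < ε := by
  have hU : {p : ℝ × ℝ | dist p.1 p.2 < ε} ∈ uniformity ℝ := Metric.dist_mem_uniformity hε
  have h1 : Dynamics.coverEntropyEntourage g F {p : ℝ × ℝ | dist p.1 p.2 < ε} < (r : EReal) :=
    (Dynamics.coverEntropyEntourage_le_coverEntropy g F hU).trans_lt h
  filter_upwards [ExpGrowth.eventually_le_exp h1] with n hn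
  rw [show ((r : EReal) * (n : EReal)) = ((r * n : ℝ) : EReal) by push_cast; rfl,
    EReal.exp_coe] at hn
  have hfin : Dynamics.coverMincard g F {p : ℝ × ℝ | dist p.1 p.2 < ε} n < ⊤ := by
    by_contra hcon
    rw [not_lt, top_le_iff] at hcon
    rw [hcon] at hn
    simp at hn
  obtain ⟨s, hs, hcard⟩ := (Dynamics.coverMincard_finite_iff _ _ _ _).1 hfin
  refine ⟨s, ?_, fun x hx => ?_⟩
  · rw [← hcard] at hn
    have h2 : ((s.card : ℕ∞) : ENNReal) = ENNReal.ofReal (s.card : ℝ) := by simp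
    rw [h2] at hn
    exact (ENNReal.ofReal_le_ofReal_iff (Real.exp_pos _).le).1 hn
  · obtain ⟨y, hy, hxy⟩ := hs hx
    refine ⟨y, hy, fun k hk => ?_⟩
    simpa [Real.dist_eq] using Dynamics.mem_dynEntourage.1 hxy k hk

end CoverEntropy

namespace Uni

variable {f : ℝ → ℝ} {a b c : ℝ}

lemma mapsTo_side (h : Uni f a b c) {x y : ℝ} (hxy : Icc x y ⊆ Icc a b) {i : ℕ}
    (hne : ∀ z ∈ Ioo x y, f^[i] z ≠ c) :
    MapsTo f^[i] (Icc x y) (Icc a c) ∨ MapsTo f^[i] (Icc x y) (Icc c b) := by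
  have hmem : ∀ z ∈ Icc x y, f^[i] z ∈ Icc a b := fun z hz => h.iterate_mem (hxy hz) i
  by_contra! hcon
  obtain ⟨h1, h2⟩ := hcon
  simp only [MapsTo, not_forall] at h1 h2
  obtain ⟨u, hu, hu'⟩ := h1
  obtain ⟨v, hv, hv'⟩ := h2
  have hu2 : c < f^[i] u := by
    by_contra! hc; exact hu' ⟨(hmem u hu).1, hc⟩
  have hv2 : f^[i] v < c := by
    by_contra! hc; exact hv' ⟨hc, (hmem v hv).2⟩
  have hcont : ContinuousOn f^[i] (Icc x y) := (h.continuousOn_iterate i).mono hxy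
  rcases le_total u v with huv | huv
  · obtain ⟨z, hz, hzc⟩ := intermediate_value_Ioo' huv (hcont.mono (Icc_subset_Icc hu.1 hv.2))
      ⟨hv2, hu2⟩
    exact hne z ⟨hu.1.trans_lt hz.1, hz.2.trans_le hv.2⟩ hzc
  · obtain ⟨z, hz, hzc⟩ := intermediate_value_Ioo huv (hcont.mono (Icc_subset_Icc hv.1 hu.2))
      ⟨hv2, hu2⟩
    exact hne z ⟨hv.1.trans_lt hz.1, hz.2.trans_le hu.2⟩ hzc

lemma injOn_iterate (h : Uni f a b c) {x y : ℝ} (hxy : Icc x y ⊆ Icc a b) (i : ℕ)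
    (hne : ∀ j < i, ∀ z ∈ Ioo x y, f^[j] z ≠ c) : InjOn f^[i] (Icc x y) := by
  induction i with
  | zero => exact injOn_id _
  | succ i ih =>
    rw [Function.iterate_succ']
    have h1 := ih fun j hj => hne j (by omega)
    rcases h.mapsTo_side hxy (hne i (Nat.lt_succ_self i)) with h2 | h2
    · exact h.injOn_left.comp h1 h2
    · exact h.injOn_right.comp h1 h2

/-- Points whose orbit hits `c` before time `n`. -/
lemma ncard_hit_before_le (h : Uni f a b c) (n : ℕ) :
    {z | z ∈ Icc a b ∧ ∃ j < n, f^[j] z = c}.Finite ∧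
    {z | z ∈ Icc a b ∧ ∃ j < n, f^[j] z = c}.ncard ≤ ∑ j ∈ Finset.range n, hits f a b c j := by
  induction n with
  | zero => simp
  | succ n ih =>
    have hsub : {z | z ∈ Icc a b ∧ ∃ j < n + 1, f^[j] z = c} =
        {z | z ∈ Icc a b ∧ ∃ j < n, f^[j] z = c} ∪ firstHit f a b c n := by
      ext z
      constructor
      · rintro ⟨hz, j, hj, hjc⟩
        by_cases hex : ∃ j < n, f^[j] z = c
        · exact Or.inl ⟨hz, hex⟩
        · have hjn : j = n := by
            by_contra hne
            exact hex ⟨j, by omega, hjc⟩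
          refine Or.inr ⟨hz, hjn ▸ hjc, fun i hi hic => hex ⟨i, hi, hic⟩⟩
      · rintro (⟨hz, j, hj, hjc⟩ | ⟨hz, hc, _⟩)
        · exact ⟨hz, j, by omega, hjc⟩
        · exact ⟨hz, n, by omega, hc⟩
    rw [hsub, Finset.sum_range_succ]
    exact ⟨ih.1.union (h.finite_firstHit n),
      (ncard_union_le _ _).trans (Nat.add_le_add_right ih.2 _)⟩

lemma ncard_fiber_le (h : Uni f a b c) (i : ℕ) (q : ℝ) :
    {x | x ∈ Icc a b ∧ f^[i] x = q}.Finite ∧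
    {x | x ∈ Icc a b ∧ f^[i] x = q}.ncard ≤ (∑ j ∈ Finset.range i, hits f a b c j) + 1 := by
  obtain ⟨hfin, hcard⟩ := h.ncard_hit_before_le i
  set P := {z | z ∈ Icc a b ∧ ∃ j < i, f^[j] z = c} with hP
  set T := {x | x ∈ Icc a b ∧ f^[i] x = q} with hT
  have hinj : StrictMonoOn (fun x => (P ∩ Iio x).ncard) T := by
    intro x hx y hy hxy
    have hsub : Icc x y ⊆ Icc a b := Icc_subset_Icc hx.1.1 hy.1.2
    have hex : ∃ z ∈ Ioo x y, z ∈ P := by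
      by_contra! hcon
      have := h.injOn_iterate hsub i fun j hj z hz hc =>
        hcon z hz ⟨hsub (Ioo_subset_Icc_self hz), j, hj, hc⟩
      exact hxy.ne (this ⟨le_rfl, hxy.le⟩ ⟨hxy.le, le_rfl⟩ (hx.2.trans hy.2.symm))
    obtain ⟨z, hz, hzP⟩ := hex
    refine ncard_lt_ncard ?_ (hfin.inter_of_left _)
    refine ssubset_iff_exists.2 ⟨fun w hw => ⟨hw.1, (mem_Iio.1 hw.2).trans hxy⟩, z, ⟨hzP, hz.2⟩, ?_⟩
    rintro ⟨_, hzx⟩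
    exact lt_asymm hz.1 hzx
  have hmaps : MapsTo (fun x => (P ∩ Iio x).ncard) T (Iio (P.ncard + 1)) := by
    intro x _
    have : (P ∩ Iio x).ncard ≤ P.ncard := ncard_le_ncard inter_subset_left hfin
    exact Nat.lt_succ_of_le this
  refine ⟨Finite.of_injOn hmaps hinj.injOn (finite_Iio _), ?_⟩
  have h1 := ncard_le_ncard_of_injOn _ hmaps hinj.injOn (finite_Iio _)
  have h2 : (Iio (P.ncard + 1)).ncard = P.ncard + 1 := by
    rw [← Finset.coe_Iio, ncard_coe_finset]; simp
  omega

lemma exists_cover (h : Uni f a b c) {ε : ℝ} (hε : 0 < ε) : ∃ K : ℕ, ∀ n : ℕ, ∃ s : Finset ℝ,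
    s.card ≤ K * n * ((∑ j ∈ Finset.range n, hits f a b c j) + 1) + 1 ∧
    ∀ x ∈ Icc a b, ∃ y ∈ s, ∀ k < n, |f^[k] x - f^[k] y| ≤ ε := by
  obtain ⟨K, hK⟩ := exists_nat_gt ((b - a) / ε)
  refine ⟨K + 1, fun n => ?_⟩
  set T : ℕ → ℕ → Set ℝ := fun i m => {x | x ∈ Icc a b ∧ f^[i] x = a + m * ε} with hT
  have hfin : ∀ i m, (T i m).Finite := fun i m => (h.ncard_fiber_le i _).1
  set E : Finset ℝ := insert a ((Finset.range n).biUnion fun i =>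
    (Finset.range (K + 1)).biUnion fun m => (hfin i m).toFinset) with hE
  have haI : a ∈ Icc a b := ⟨le_rfl, (h.lt_left.trans h.lt_right).le⟩
  refine ⟨E, ?_, ?_⟩
  · have hcard : ∀ i ∈ Finset.range n, ∀ m ∈ Finset.range (K + 1), (hfin i m).toFinset.card ≤
        (∑ j ∈ Finset.range n, hits f a b c j) + 1 := by
      intro i hi m _
      rw [← ncard_eq_toFinset_card _ (hfin i m)]
      refine (h.ncard_fiber_le i _).2.trans (Nat.add_le_add_right ?_ 1)
      exact Finset.sum_le_sum_of_subset (Finset.range_subset_range.2 (Finset.mem_range.1 hi).le)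
    refine (Finset.card_insert_le _ _).trans (Nat.add_le_add_right ?_ 1)
    have h1 := Finset.card_biUnion_le_card_mul (Finset.range n) (fun i =>
      (Finset.range (K + 1)).biUnion fun m => (hfin i m).toFinset) _ fun i hi =>
        Finset.card_biUnion_le_card_mul _ _ _ (hcard i hi)
    rw [Finset.card_range, Finset.card_range] at h1
    refine h1.trans (le_of_eq (by ring))
  · intro x hx
    have hne : (E.filter (· ≤ x)).Nonempty := ⟨a, by simp [hE, hx.1]⟩
    obtain ⟨y, hy⟩ : ∃ y, y = (E.filter (· ≤ x)).max' hne := ⟨_, rfl⟩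
    have hymem := (E.filter (· ≤ x)).max'_mem hne
    rw [← hy, Finset.mem_filter] at hymem
    have hyI : y ∈ Icc a b := by
      refine ⟨?_, hymem.2.trans hx.2⟩
      rw [hy]; exact Finset.le_max' _ _ (by simp [hE, hx.1])
    refine ⟨y, hymem.1, fun k hk => ?_⟩
    have hfree : ∀ w ∈ Ioo y x, ∀ m ≤ K, f^[k] w ≠ a + m * ε := by
      intro w hw m hm hwm
      have hwI : w ∈ Icc a b := ⟨hyI.1.trans hw.1.le, hw.2.le.trans hx.2⟩
      have : w ∈ E.filter (· ≤ x) := by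
        rw [Finset.mem_filter]
        refine ⟨Finset.mem_insert_of_mem ?_, hw.2.le⟩
        refine Finset.mem_biUnion.2 ⟨k, Finset.mem_range.2 hk, Finset.mem_biUnion.2
          ⟨m, Finset.mem_range.2 (by omega), ?_⟩⟩
        rw [Finite.mem_toFinset]
        exact ⟨hwI, hwm⟩
      have := Finset.le_max' _ _ this
      rw [← hy] at this
      exact absurd hw.1 (not_lt.2 this)
    have hgrid : ∀ u v : ℝ, u ∈ Icc a b → v ∈ Icc a b → ε < v - u →
        ∃ m ≤ K, a + (m : ℝ) * ε ∈ Ioo u v := by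
      intro u v hu hv huv
      have h0 : 0 ≤ (u - a) / ε := div_nonneg (by linarith [hu.1]) hε.le
      refine ⟨⌊(u - a) / ε⌋₊ + 1, ?_, ?_, ?_⟩
      · have h1 := Nat.floor_le h0
        have h2 : (u - a) / ε + 1 ≤ (b - a) / ε := by
          rw [div_add_one hε.ne']; gcongr; linarith [hv.2]
        have : ((⌊(u - a) / ε⌋₊ + 1 : ℕ) : ℝ) < K := by push_cast; linarith
        exact_mod_cast this.le
      · have h1 := Nat.lt_floor_add_one ((u - a) / ε)
        rw [div_lt_iff₀ hε] at h1
        push_cast; linarith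
      · have h1 := Nat.floor_le h0
        rw [le_div_iff₀ hε] at h1
        push_cast; linarith
    have hcont : ContinuousOn f^[k] (Icc y x) :=
      (h.continuousOn_iterate k).mono (Icc_subset_Icc hyI.1 hx.2)
    by_contra! hcon
    rcases lt_abs.1 hcon with hlt | hlt
    · obtain ⟨m, hm, hmem⟩ := hgrid _ _ (h.iterate_mem hyI k) (h.iterate_mem hx k) hlt
      obtain ⟨w, hw, hwm⟩ := intermediate_value_Ioo hymem.2 hcont hmem
      exact hfree w hw m hm hwm
    · obtain ⟨m, hm, hmem⟩ := hgrid _ _ (h.iterate_mem hx k) (h.iterate_mem hyI k) (by linarith)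
      obtain ⟨w, hw, hwm⟩ := intermediate_value_Ioo' hymem.2 hcont hmem
      exact hfree w hw m hm hwm

/-- If `∑ a_n x^n` converges, the entropy is at most `-log x`. -/
lemma coverEntropy_le (h : Uni f a b c) {x : ℝ} (hx0 : 0 < x) (hx1 : x < 1)
    (hs : Summable fun n => (hits f a b c n : ℝ) * x ^ n) :
    Dynamics.coverEntropy f (Icc a b) ≤ ((-Real.log x : ℝ) : EReal) := by
  refine EReal.le_of_forall_lt_iff_le.1 fun r hr => ?_
  have hr' : -Real.log x < r := by exact_mod_cast hr
  refine coverEntropy_le_of_forall_cover fun ε hε => ?_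
  obtain ⟨K, hK⟩ := h.exists_cover (half_pos hε)
  set A := ∑' n, (hits f a b c n : ℝ) * x ^ n with hA
  have hA0 : 0 ≤ A := tsum_nonneg fun n => by positivity
  have hsum : ∀ n : ℕ, (∑ j ∈ Finset.range n, (hits f a b c j : ℝ)) ≤ A * (x⁻¹) ^ n := by
    intro n
    have h1 : ∑ j ∈ Finset.range n, (hits f a b c j : ℝ) * x ^ j ≤ A :=
      hs.sum_le_tsum _ fun i _ => by positivity
    have h2 : (∑ j ∈ Finset.range n, (hits f a b c j : ℝ)) * x ^ n ≤ A := by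
      rw [Finset.sum_mul]
      refine le_trans (Finset.sum_le_sum fun j hj => ?_) h1
      have := pow_le_pow_of_le_one hx0.le hx1.le (Finset.mem_range.1 hj).le
      gcongr
    rw [inv_pow, ← div_eq_mul_inv, le_div_iff₀ (by positivity)]
    exact h2
  -- polynomial factors are absorbed by a slightly larger exponential rate
  have hq0 : 0 < x⁻¹ * Real.exp (-r) := by positivity
  have hq1 : x⁻¹ * Real.exp (-r) < 1 := by
    rw [← Real.exp_log hx0, ← Real.exp_neg, ← Real.exp_add, Real.exp_lt_one_iff]; linarith
  have hlim : Tendsto (fun n : ℕ => ((K * (A + 1) : ℝ) * (n * (x⁻¹ * Real.exp (-r)) ^ n) +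
      (x⁻¹ * Real.exp (-r)) ^ n)) atTop (𝓝 0) := by
    have h1 := (tendsto_self_mul_const_pow_of_lt_one hq0.le hq1).const_mul (K * (A + 1) : ℝ)
    have h2 := tendsto_pow_atTop_nhds_zero_of_lt_one hq0.le hq1
    simpa using h1.add h2
  filter_upwards [hlim.eventually (ge_mem_nhds one_pos)] with n hn
  obtain ⟨s, hs1, hs2⟩ := hK n
  refine ⟨s, ?_, fun y hy => ?_⟩
  · have hx1n : 1 ≤ (x⁻¹) ^ n := one_le_pow₀ ((one_le_inv₀ hx0).2 hx1.le)
    have h1 : (s.card : ℝ) ≤ K * n * ((∑ j ∈ Finset.range n, (hits f a b c j : ℝ)) + 1) + 1 := by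
      exact_mod_cast hs1
    have h2 : (∑ j ∈ Finset.range n, (hits f a b c j : ℝ)) + 1 ≤ (A + 1) * (x⁻¹) ^ n := by
      linarith [hsum n]
    have h3 : (s.card : ℝ) ≤ (K * (A + 1) * n + 1) * (x⁻¹) ^ n := by
      calc (s.card : ℝ) ≤ K * n * ((A + 1) * (x⁻¹) ^ n) + 1 * (x⁻¹) ^ n := by
            refine h1.trans (add_le_add ?_ (by linarith)); gcongr
        _ = _ := by ring
    refine h3.trans ?_
    rw [mul_pow, ← Real.exp_nat_mul] at hn
    have h4 : Real.exp (r * n) * Real.exp (n * -r) = 1 := by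
      rw [← Real.exp_add]; simp; ring
    calc (K * (A + 1) * n + 1) * (x⁻¹) ^ n
        = Real.exp (r * n) * Real.exp (n * -r) * ((K * (A + 1) * n + 1) * (x⁻¹) ^ n) := by
          rw [h4, one_mul]
      _ = Real.exp (r * n) * (K * (A + 1) * (n * (x⁻¹ ^ n * Real.exp (n * -r))) +
          x⁻¹ ^ n * Real.exp (n * -r)) := by ring
      _ ≤ Real.exp (r * n) * 1 := by gcongr
      _ = _ := mul_one _
  · obtain ⟨z, hz, hyz⟩ := hs2 y hy
    exact ⟨z, hz, fun k hk => (hyz k hk).trans_lt (half_lt_self hε)⟩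

end Uni

namespace Uni

variable {f : ℝ → ℝ} {a b c : ℝ}

lemma iterate_mem_firstHit (h : Uni f a b c) {m n : ℕ} {x : ℝ}
    (hx : x ∈ firstHit f a b c (m + n)) : f^[m] x ∈ firstHit f a b c n := by
  obtain ⟨h1, h2, h3⟩ := hx
  refine ⟨h.iterate_mem h1 m, ?_, fun i hi => ?_⟩
  · rw [← Function.iterate_add_apply, add_comm]; exact h2
  · rw [← Function.iterate_add_apply, add_comm]; exact h3 _ (by omega)

lemma injOn_iterate_of_side (h : Uni f a b c) {T : Set ℝ} (m : ℕ)
    (hT : ∀ j < m, MapsTo f^[j] T (Icc a c) ∨ MapsTo f^[j] T (Icc c b)) : InjOn f^[m] T := by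
  induction m with
  | zero => exact injOn_id _
  | succ m ih =>
    rw [Function.iterate_succ']
    have h1 := ih fun j hj => hT j (by omega)
    rcases hT m (Nat.lt_succ_self m) with h2 | h2
    · exact h.injOn_left.comp h1 h2
    · exact h.injOn_right.comp h1 h2

/-- Points of `firstHit n` whose orbits shadow each other are few. -/
lemma ncard_shadow_le (h : Uni f a b c) {e : ℕ → ℝ} {δ : ℝ} {M : ℕ}
    (he : ∀ j < M, e j = 1 ∨ e j = -1)
    (hδ : ∀ x ∈ Icc a b, x ≠ c → |x - c| < δ → ∀ j < M, 0 < e j * (c - f^[j + 1] x)) (n : ℕ) :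
    ∀ S ⊆ firstHit f a b c n, (∀ x ∈ S, ∀ y ∈ S, ∀ j < n, |f^[j] x - f^[j] y| < δ) →
      S.ncard ≤ 2 ^ (n / (M + 1) + 1) := by
  induction n using Nat.strong_induction_on with
  | _ n ih =>
  intro S hS hd
  rcases Nat.eq_zero_or_pos n with rfl | hn
  · rw [h.firstHit_zero] at hS
    have := ncard_le_ncard hS
    rw [ncard_singleton] at this
    simpa using this.trans one_le_two
  have hI : ∀ x ∈ S, x ∈ Icc a b := fun x hx => (hS hx).1
  have hne : ∀ x ∈ S, x ≠ c := fun x hx => (hS hx).2.2 0 hn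
  have hSfin : S.Finite := (h.finite_firstHit n).subset hS
  have push : ∀ (m : ℕ) (T : Set ℝ), T ⊆ S → 1 ≤ m → m ≤ n → InjOn f^[m] T →
      T.ncard ≤ 2 ^ ((n - m) / (M + 1) + 1) := by
    intro m T hT hm hmn hinj
    obtain ⟨l, rfl⟩ := Nat.exists_eq_add_of_le hmn
    rw [← hinj.ncard_image]
    rw [Nat.add_sub_cancel_left]
    refine ih l (by omega) _ ?_ ?_
    · rintro _ ⟨x, hx, rfl⟩
      exact h.iterate_mem_firstHit (hS (hT hx))
    · rintro _ ⟨x, hx, rfl⟩ _ ⟨y, hy, rfl⟩ j hj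
      rw [← Function.iterate_add_apply, ← Function.iterate_add_apply]
      exact hd x (hT hx) y (hT hy) _ (by omega)
  by_cases hL : ∀ x ∈ S, x ≤ c
  · refine (push 1 S subset_rfl le_rfl hn ?_).trans
      (Nat.pow_le_pow_right two_pos (Nat.succ_le_succ (Nat.div_le_div_right (by omega))))
    exact h.injOn_left.mono (show S ⊆ Icc a c from fun x hx => ⟨(hI x hx).1, hL x hx⟩)
  by_cases hR : ∀ x ∈ S, c ≤ x
  · refine (push 1 S subset_rfl le_rfl hn ?_).trans
      (Nat.pow_le_pow_right two_pos (Nat.succ_le_succ (Nat.div_le_div_right (by omega))))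
    exact h.injOn_right.mono (show S ⊆ Icc c b from fun x hx => ⟨hR x hx, (hI x hx).2⟩)
  push Not at hL hR
  obtain ⟨y, hy, hyc⟩ := hL
  obtain ⟨x, hx, hxc⟩ := hR
  have hnear : ∀ z ∈ S, |z - c| < δ := by
    intro z hz
    have h1 := abs_lt.1 (hd z hz y hy 0 hn)
    have h2 := abs_lt.1 (hd z hz x hx 0 hn)
    simp only [Function.iterate_zero, id] at h1 h2
    rw [abs_lt]; constructor <;> linarith
  have hsign : ∀ z ∈ S, ∀ j < M, 0 < e j * (c - f^[j + 1] z) := fun z hz =>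
    hδ z (hI z hz) (hne z hz) (hnear z hz)
  have hMn : M + 1 ≤ n := by
    by_contra! hlt
    have := hsign x hx (n - 1) (by omega)
    rw [Nat.sub_add_cancel hn, (hS hx).2.1] at this
    simp at this
  have hside : ∀ T ⊆ S, (MapsTo f^[0] T (Icc a c) ∨ MapsTo f^[0] T (Icc c b)) →
      InjOn f^[M + 1] T := by
    intro T hT h0
    refine h.injOn_iterate_of_side _ fun j hj => ?_
    rcases j with _ | j
    · exact h0
    rcases he j (by omega) with hj1 | hj1
    · refine Or.inl fun z hz => ⟨(h.iterate_mem (hI z (hT hz)) _).1, ?_⟩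
      have := hsign z (hT hz) j (by omega)
      rw [hj1] at this; linarith
    · refine Or.inr fun z hz => ⟨?_, (h.iterate_mem (hI z (hT hz)) _).2⟩
      have := hsign z (hT hz) j (by omega)
      rw [hj1] at this; linarith
  have hcov : S = (S ∩ Iic c) ∪ (S ∩ Ici c) := by
    rw [← inter_union_distrib_left, Iic_union_Ici, inter_univ]
  have h1 := push (M + 1) (S ∩ Iic c) inter_subset_left (by omega) hMn
    (hside _ inter_subset_left (Or.inl fun z hz => ⟨(hI z hz.1).1, hz.2⟩))
  have h2 := push (M + 1) (S ∩ Ici c) inter_subset_left (by omega) hMn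
    (hside _ inter_subset_left (Or.inr fun z hz => ⟨hz.2, (hI z hz.1).2⟩))
  have h3 : n / (M + 1) = (n - (M + 1)) / (M + 1) + 1 := by
    rw [Nat.div_eq_sub_div (by omega) hMn]
  rw [h3, pow_succ, hcov]
  refine (ncard_union_le _ _).trans ?_
  omega

/-- If the entropy is smaller than `-log x`, then `∑ a_n x^n` converges. -/
lemma summable_of_coverEntropy_lt (h : Uni f a b c) {x : ℝ} (hx0 : 0 < x)
    (hs : Dynamics.coverEntropy f (Icc a b) < ((-Real.log x : ℝ) : EReal)) :
    Summable fun n => (hits f a b c n : ℝ) * x ^ n := by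
  obtain ⟨r, hr1, hr2⟩ := EReal.lt_iff_exists_real_btwn.1 hs
  have hr2 : r < -Real.log x := by exact_mod_cast hr2
  obtain ⟨e, he⟩ := h.exists_kneading
  obtain ⟨M, hM⟩ := exists_nat_gt (Real.log 2 / (-Real.log x - r))
  rw [div_lt_iff₀ (by linarith)] at hM
  have hev : ∀ᶠ z in 𝓝[≠] c, ∀ j < M, 0 < e j * (c - f^[j + 1] z) := by
    have := (Finset.range M).eventually_all (l := 𝓝[≠] c)
      (p := fun j z => 0 < e j * (c - f^[j + 1] z))
    simp only [Finset.mem_range] at this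
    exact this.2 fun j _ => (he j).2
  rw [eventually_nhdsWithin_iff, Metric.eventually_nhds_iff] at hev
  obtain ⟨δ, hδ0, hδ⟩ := hev
  set w : ℝ := r + Real.log 2 / (M + 1) with hw
  have hwx : w < -Real.log x := by
    have : Real.log 2 / (M + 1) < -Real.log x - r := by
      rw [div_lt_iff₀ (by positivity)]; nlinarith
    linarith
  have hbound : ∀ᶠ n : ℕ in atTop, (hits f a b c n : ℝ) ≤ 2 * Real.exp (w * n) := by
    filter_upwards [eventually_exists_cover hr1 (half_pos hδ0)] with n ⟨s, hs1, hs2⟩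
    set S : ℝ → Set ℝ := fun y =>
      {z | z ∈ firstHit f a b c n ∧ ∀ k < n, |f^[k] z - f^[k] y| < δ / 2}
    have hS : ∀ y, (S y).ncard ≤ 2 ^ (n / (M + 1) + 1) := by
      intro y
      refine h.ncard_shadow_le (fun j _ => (he j).1)
        (fun z _ hz hzδ => hδ (by simpa [Real.dist_eq] using hzδ) hz) n _ (fun z hz => hz.1) ?_
      intro u hu v hv j hj
      have h1 := abs_lt.1 (hu.2 j hj)
      have h2 := abs_lt.1 (hv.2 j hj)
      rw [abs_lt]; constructor <;> linarith
    have hsub : firstHit f a b c n ⊆ ⋃ y ∈ s, S y := by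
      intro z hz
      obtain ⟨y, hy, hyz⟩ := hs2 z hz.1
      exact mem_biUnion hy ⟨hz, hyz⟩
    have hfin : (⋃ y ∈ s, S y).Finite := by
      refine (h.finite_firstHit n).subset (iUnion₂_subset fun y _ z hz => hz.1)
    have h1 : hits f a b c n ≤ s.card * 2 ^ (n / (M + 1) + 1) := by
      refine (ncard_le_ncard hsub hfin).trans ?_
      refine (Finset.set_ncard_biUnion_le s S).trans ?_
      exact (Finset.sum_le_card_nsmul _ _ _ fun y _ => hS y).trans_eq (smul_eq_mul _ _)
    have h2 : ((2 : ℝ) ^ (n / (M + 1) : ℕ)) ≤ Real.exp (Real.log 2 / (M + 1) * n) := by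
      rw [← Real.exp_log (two_pos), ← Real.exp_nat_mul, Real.exp_log two_pos, Real.exp_le_exp]
      have : ((n / (M + 1) : ℕ) : ℝ) ≤ (n : ℝ) / ((M + 1 : ℕ) : ℝ) := Nat.cast_div_le
      push_cast at this
      calc _ ≤ (n : ℝ) / (M + 1) * Real.log 2 := by
            have := Real.log_pos one_lt_two
            gcongr
        _ = _ := by ring
    calc (hits f a b c n : ℝ) ≤ s.card * 2 ^ (n / (M + 1) + 1) := by exact_mod_cast h1
      _ = 2 * (s.card * 2 ^ (n / (M + 1))) := by ring
      _ ≤ 2 * (Real.exp (r * n) * Real.exp (Real.log 2 / (M + 1) * n)) := by gcongr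
      _ = _ := by rw [← Real.exp_add, hw]; ring_nf
  have hq0 : 0 ≤ Real.exp w * x := by positivity
  have hq1 : Real.exp w * x < 1 := by
    rw [← Real.exp_log hx0, ← Real.exp_add, Real.exp_lt_one_iff]; linarith
  refine summable_of_isBigO_nat ((summable_geometric_of_lt_one hq0 hq1).mul_left 2) ?_
  refine Asymptotics.IsBigO.of_bound 1 ?_
  filter_upwards [hbound] with n hn
  rw [one_mul, Real.norm_of_nonneg (by positivity), Real.norm_of_nonneg (by positivity), mul_pow,
    ← Real.exp_nat_mul, mul_comm (n : ℝ) w, ← mul_assoc]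
  gcongr

lemma hits_le (h : Uni f a b c) (n : ℕ) : hits f a b c n ≤ 2 ^ n := by
  induction n with
  | zero => simp [h.hits_zero]
  | succ n ih =>
    rw [h.hits_succ, pow_succ, mul_comm]
    exact Nat.mul_le_mul_right 2
      ((ncard_le_ncard inter_subset_left (h.finite_firstHit n)).trans ih)

lemma coverEntropy_le_log_three (h : Uni f a b c) :
    Dynamics.coverEntropy f (Icc a b) ≤ ((Real.log 3 : ℝ) : EReal) := by
  have hs : Summable fun n => (hits f a b c n : ℝ) * (1 / 3 : ℝ) ^ n := by
    refine Summable.of_nonneg_of_le (fun n => by positivity) (fun n => ?_)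
      (summable_geometric_of_lt_one (r := (2 / 3 : ℝ)) (by norm_num) (by norm_num))
    have : (hits f a b c n : ℝ) ≤ 2 ^ n := by exact_mod_cast h.hits_le n
    calc (hits f a b c n : ℝ) * (1 / 3 : ℝ) ^ n ≤ 2 ^ n * (1 / 3 : ℝ) ^ n := by gcongr
      _ = _ := by rw [← mul_pow]; norm_num
  have := h.coverEntropy_le (by norm_num) (by norm_num) hs
  simpa using this

/-- The entropy is a real number `H ∈ [0, log 3]`, and `exp (-H)` is the radius of convergence of
the generating function of `hits`. -/
lemma entropy_spec (h : Uni f a b c) {H : ℝ}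
    (hH : H = (Dynamics.coverEntropy f (Icc a b)).toReal) :
    0 ≤ H ∧ H ≤ Real.log 3 ∧
    (∀ x, 0 < x → x < Real.exp (-H) → Summable fun n => (hits f a b c n : ℝ) * x ^ n) ∧
    (∀ x, Real.exp (-H) < x → x < 1 → ¬ Summable fun n => (hits f a b c n : ℝ) * x ^ n) := by
  have h0 : 0 ≤ Dynamics.coverEntropy f (Icc a b) :=
    Dynamics.coverEntropy_nonneg _ ⟨c, h.c_mem⟩
  have h1 := h.coverEntropy_le_log_three
  have hreal : ((H : ℝ) : EReal) = Dynamics.coverEntropy f (Icc a b) := by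
    rw [hH]
    refine EReal.coe_toReal ?_ ?_
    · exact (h1.trans_lt (EReal.coe_lt_top _)).ne
    · exact ((EReal.bot_lt_zero).trans_le h0).ne'
  rw [← hreal] at h0 h1
  refine ⟨by exact_mod_cast h0, by exact_mod_cast h1, fun x hx0 hx => ?_, fun x hx hx1 hs => ?_⟩
  · refine h.summable_of_coverEntropy_lt hx0 ?_
    rw [← hreal, EReal.coe_lt_coe_iff]
    have := Real.log_lt_log hx0 hx
    rw [Real.log_exp] at this; linarith
  · have hx0 := (Real.exp_pos _).trans hx
    have h2 := h.coverEntropy_le hx0 hx1 hs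
    rw [← hreal, EReal.coe_le_coe_iff] at h2
    have := Real.log_lt_log (Real.exp_pos _) hx
    rw [Real.log_exp] at this; linarith

end Uni

/-- All power series `∑ hits n * x ^ n` with `x < 1` converge. -/
def SubexpHits (f : ℝ → ℝ) (a b c : ℝ) : Prop :=
  ∀ x : ℝ, 0 < x → x < 1 → Summable fun n => (hits f a b c n : ℝ) * x ^ n

/-- The second iterate, conjugated by `x ↦ -x`. -/
def negSq (f : ℝ → ℝ) (x : ℝ) : ℝ := -f (f (-x))

lemma iterate_negSq (f : ℝ → ℝ) (n : ℕ) (x : ℝ) : (negSq f)^[n] x = -f^[2 * n] (-x) := by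
  induction n with
  | zero => simp
  | succ n ih =>
    rw [Function.iterate_succ_apply', ih, negSq, neg_neg, show 2 * (n + 1) = 2 * n + 1 + 1 by ring,
      Function.iterate_succ_apply', Function.iterate_succ_apply']

/-- `q` is the orientation reversing fixed point of `f` and `q'` its other preimage. -/
structure RevFix (f : ℝ → ℝ) (a c q q' : ℝ) : Prop where
  mem : q ∈ Ioo c (f c)
  fix : f q = q
  mem' : q' ∈ Ioo a c
  map' : f q' = q

namespace Uni

variable {f : ℝ → ℝ} {a b c : ℝ}

lemma exists_revFix (h : Uni f a b c) (h1 : c < f c) (h2 : f (f c) < c) :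
    ∃ q q', RevFix f a c q q' := by
  have hfc := h.max_mem
  have hc1 : ContinuousOn (fun x => f x - x) (Icc c (f c)) :=
    (h.cont.mono (Icc_subset_Icc h.lt_left.le hfc.2)).sub continuousOn_id
  obtain ⟨q, hq, hq'⟩ := intermediate_value_Ioo' h1.le hc1
    (show (0 : ℝ) ∈ Ioo _ _ from ⟨by linarith, by linarith⟩)
  have hc2 : ContinuousOn f (Icc a c) := h.cont.mono (Icc_subset_Icc le_rfl h.lt_right.le)
  obtain ⟨q', hq2, hq2'⟩ := intermediate_value_Ioo h.lt_left.le hc2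
    (show q ∈ Ioo _ _ from ⟨by rw [h.map_left]; linarith [h.lt_left, hq.1], hq.2⟩)
  exact ⟨q, q', hq, by linarith, hq2, hq2'⟩

variable {q q' : ℝ}

lemma mapsTo_inner (h : Uni f a b c) (hq : RevFix f a c q q') :
    MapsTo f (Icc q' q) (Icc q (f c)) := by
  have hqb : q < b := hq.mem.2.trans_le h.max_mem.2
  intro x hx
  refine ⟨?_, h.le_max ⟨hq.mem'.1.le.trans hx.1, hx.2.trans hqb.le⟩⟩
  rcases le_total x c with hxc | hxc
  · rw [← hq.map']
    exact h.mono.monotoneOn ⟨hq.mem'.1.le, hq.mem'.2.le⟩ ⟨hq.mem'.1.le.trans hx.1, hxc⟩ hx.1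
  · calc q = f q := hq.fix.symm
      _ ≤ f x := h.anti.antitoneOn ⟨hxc, hx.2.trans hqb.le⟩ ⟨hq.mem.1.le, hqb.le⟩ hx.2

lemma mapsTo_outer (h : Uni f a b c) (hq : RevFix f a c q q') :
    MapsTo f (Icc q (f c)) (Icc (f (f c)) q) := by
  have hqb : q < b := hq.mem.2.trans_le h.max_mem.2
  have hc1 : f c ∈ Icc c b := ⟨(hq.mem.1.trans hq.mem.2).le, h.max_mem.2⟩
  intro x hx
  have hxI : x ∈ Icc c b := ⟨hq.mem.1.le.trans hx.1, hx.2.trans hc1.2⟩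
  refine ⟨h.anti.antitoneOn hxI hc1 hx.2, ?_⟩
  calc f x ≤ f q := h.anti.antitoneOn ⟨hq.mem.1.le, hqb.le⟩ hxI hx.1
    _ = q := hq.fix

lemma uni_negSq (h : Uni f a b c) (hq : RevFix f a c q q') (hc : q' ≤ f (f c)) :
    Uni (negSq f) (-q) (-q') (-c) := by
  have hqb : q < b := hq.mem.2.trans_le h.max_mem.2
  have hsub : Icc q' q ⊆ Icc a b := Icc_subset_Icc hq.mem'.1.le hqb.le
  have hsub' : Icc q (f c) ⊆ Icc c b := Icc_subset_Icc hq.mem.1.le h.max_mem.2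
  have hneg : MapsTo (fun x : ℝ => -x) (Icc (-q) (-q')) (Icc q' q) := fun x hx =>
    ⟨by linarith [hx.2], by linarith [hx.1]⟩
  have hin := h.mapsTo_inner hq
  have hout := h.mapsTo_outer hq
  refine ⟨by linarith [hq.mem.1], by linarith [hq.mem'.2], ?_, ?_, ?_, ?_, ?_, ?_⟩
  · intro x hx
    have := hout (hin (hneg hx))
    exact ⟨neg_le_neg this.2, neg_le_neg (hc.trans this.1)⟩
  · refine ((h.cont.mono (hsub'.trans (Icc_subset_Icc h.lt_left.le le_rfl))).comp
      ((h.cont.mono hsub).comp continuous_neg.continuousOn hneg) ?_).neg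
    exact hin.comp hneg
  · intro x hx y hy hxy
    have hx1 : -x ∈ Icc c b := ⟨by linarith [hx.2], by linarith [hx.1]⟩
    have hy1 : -y ∈ Icc c b := ⟨by linarith [hy.2], by linarith [hy.1]⟩
    have hx2 := hsub' (hin (hneg ⟨hx.1, by linarith [hx.2, hq.mem'.2]⟩))
    have hy2 := hsub' (hin (hneg ⟨hy.1, by linarith [hy.2, hq.mem'.2]⟩))
    exact neg_lt_neg (h.anti hx2 hy2 (h.anti hy1 hx1 (neg_lt_neg hxy)))
  · intro x hx y hy hxy
    have hx1 : -x ∈ Icc a c := ⟨by linarith [hx.2, hq.mem'.1], by linarith [hx.1]⟩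
    have hy1 : -y ∈ Icc a c := ⟨by linarith [hy.2, hq.mem'.1], by linarith [hy.1]⟩
    have hx2 := hsub' (hin (hneg ⟨by linarith [hx.1, hq.mem.1], hx.2⟩))
    have hy2 := hsub' (hin (hneg ⟨by linarith [hy.1, hq.mem.1], hy.2⟩))
    exact neg_lt_neg (h.anti hy2 hx2 (h.mono hy1 hx1 (neg_lt_neg hxy)))
  · simp [negSq, hq.fix]
  · simp [negSq, hq.fix, hq.map']

lemma iterate_even_mem (h : Uni f a b c) (hq : RevFix f a c q q') (hc : q' ≤ f (f c)) {x : ℝ}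
    (hx : x ∈ Icc q' q) (n : ℕ) : f^[2 * n] x ∈ Icc q' q := by
  have h1 := (h.uni_negSq hq hc).iterate_mem (x := -x) ⟨neg_le_neg hx.2, neg_le_neg hx.1⟩ n
  rw [iterate_negSq, neg_neg] at h1
  exact ⟨neg_le_neg_iff.1 h1.2, neg_le_neg_iff.1 h1.1⟩

lemma lt_iterate_odd (h : Uni f a b c) (hq : RevFix f a c q q') (hc : q' ≤ f (f c)) {x : ℝ}
    (hx : x ∈ Icc q' q) (n : ℕ) : c < f^[2 * n + 1] x := by
  rw [Function.iterate_succ_apply']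
  exact hq.mem.1.trans_le (h.mapsTo_inner hq (h.iterate_even_mem hq hc hx n)).1

lemma mem_firstHit_negSq (h : Uni f a b c) (hq : RevFix f a c q q') (hc : q' ≤ f (f c)) {x : ℝ}
    {n : ℕ} : -x ∈ firstHit (negSq f) (-q) (-q') (-c) n ↔
      x ∈ Icc q' q ∧ x ∈ firstHit f a b c (2 * n) := by
  have hqb : q < b := hq.mem.2.trans_le h.max_mem.2
  constructor
  · rintro ⟨h1, h2, h3⟩
    have hx : x ∈ Icc q' q := ⟨neg_le_neg_iff.1 h1.2, neg_le_neg_iff.1 h1.1⟩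
    refine ⟨hx, ⟨hq.mem'.1.le.trans hx.1, hx.2.trans hqb.le⟩, ?_, fun i hi hic => ?_⟩
    · rw [iterate_negSq, neg_neg] at h2; exact neg_inj.1 h2
    · rcases Nat.even_or_odd' i with ⟨j, rfl | rfl⟩
      · refine h3 j (by omega) ?_
        rw [iterate_negSq, neg_neg, hic]
      · exact (h.lt_iterate_odd hq hc hx j).ne' hic
  · rintro ⟨hx, -, h2, h3⟩
    refine ⟨⟨neg_le_neg hx.2, neg_le_neg hx.1⟩, ?_, fun i hi hic => ?_⟩
    · rw [iterate_negSq, neg_neg, h2]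
    · rw [iterate_negSq, neg_neg, neg_inj] at hic
      exact h3 (2 * i) (by omega) hic

lemma hits_negSq (h : Uni f a b c) (hq : RevFix f a c q q') (hc : q' ≤ f (f c)) (n : ℕ) :
    hits (negSq f) (-q) (-q') (-c) n = (Icc q' q ∩ firstHit f a b c (2 * n)).ncard := by
  rw [hits, ← ncard_image_of_injective (Icc q' q ∩ firstHit f a b c (2 * n)) neg_injective]
  congr 1
  ext x
  constructor
  · intro hx
    rw [← neg_neg x, h.mem_firstHit_negSq hq hc] at hx
    exact ⟨-x, hx, neg_neg x⟩
  · rintro ⟨y, hy, rfl⟩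
    exact (h.mem_firstHit_negSq hq hc).2 hy

lemma firstHit_inner_odd (h : Uni f a b c) (hq : RevFix f a c q q') (hc : q' ≤ f (f c)) (n : ℕ) :
    Icc q' q ∩ firstHit f a b c (2 * n + 1) = ∅ := by
  refine eq_empty_of_forall_notMem ?_
  rintro x ⟨hx, -, h2, -⟩
  exact (h.lt_iterate_odd hq hc hx n).ne' h2

lemma subexpHits_negSq (h : Uni f a b c) (hs : SubexpHits f a b c) (hq : RevFix f a c q q')
    (hc : q' ≤ f (f c)) : SubexpHits (negSq f) (-q) (-q') (-c) := by
  intro x hx0 hx1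
  have h1 := hs (√x) (Real.sqrt_pos.2 hx0) (by rw [Real.sqrt_lt' one_pos]; simpa using hx1)
  have h2 := h1.comp_injective (mul_right_injective₀ (two_ne_zero : (2 : ℕ) ≠ 0))
  refine Summable.of_nonneg_of_le (fun n => by positivity) (fun n => ?_) h2
  simp only [Function.comp]
  rw [pow_mul, Real.sq_sqrt hx0.le, h.hits_negSq hq hc]
  have : (Icc q' q ∩ firstHit f a b c (2 * n)).ncard ≤ hits f a b c (2 * n) :=
    ncard_le_ncard inter_subset_right (h.finite_firstHit _)
  gcongr

lemma hits_succ_le (h : Uni f a b c) (hq : RevFix f a c q q') (n : ℕ) :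
    (firstHit f a b c (n + 1) ∩ Iio q').ncard ≤
      (firstHit f a b c n ∩ Iio q').ncard + (Icc q' q ∩ firstHit f a b c n).ncard ∧
    hits f a b c (n + 1) ≤ (Icc q' q ∩ firstHit f a b c (n + 1)).ncard +
      2 * ((firstHit f a b c n ∩ Iio q').ncard + (Icc q' q ∩ firstHit f a b c n).ncard) := by
  have hqb : q < b := hq.mem.2.trans_le h.max_mem.2
  have h1 := h.ncard_left ⟨hq.mem'.1.le, hq.mem'.2.le⟩ n
  have h2 := h.ncard_right ⟨hq.mem.1.le, hqb.le⟩ n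
  rw [hq.map'] at h1
  rw [hq.fix] at h2
  have h3 : (firstHit f a b c n ∩ Iio q).ncard ≤
      (firstHit f a b c n ∩ Iio q').ncard + (Icc q' q ∩ firstHit f a b c n).ncard := by
    refine (ncard_le_ncard ?_ (((h.finite_firstHit n).inter_of_left _).union
      ((h.finite_firstHit n).inter_of_right _))).trans (ncard_union_le _ _)
    rintro x ⟨hx, hxq⟩
    rcases lt_or_ge x q' with hlt | hge
    · exact Or.inl ⟨hx, hlt⟩
    · exact Or.inr ⟨⟨hge, le_of_lt hxq⟩, hx⟩
  refine ⟨h1.trans_le h3, ?_⟩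
  have h4 : hits f a b c (n + 1) ≤ (Icc q' q ∩ firstHit f a b c (n + 1)).ncard +
      ((firstHit f a b c (n + 1) ∩ Iio q').ncard + (firstHit f a b c (n + 1) ∩ Ioi q).ncard) := by
    have hf := h.finite_firstHit (n + 1)
    refine (ncard_le_ncard ?_ ((hf.inter_of_right _).union
      ((hf.inter_of_left (Iio q')).union (hf.inter_of_left (Ioi q))))).trans
      ((ncard_union_le _ _).trans (Nat.add_le_add_left (ncard_union_le _ _) _))
    intro x hx
    rcases lt_or_ge x q' with hlt | hge
    · exact Or.inr (Or.inl ⟨hx, hlt⟩)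
    rcases lt_or_ge q x with hlt' | hge'
    · exact Or.inr (Or.inr ⟨hx, hlt'⟩)
    · exact Or.inl ⟨⟨hge, hge'⟩, hx⟩
  omega

lemma hits_le_two_mul_sum (h : Uni f a b c) (hq : RevFix f a c q q') (n : ℕ) :
    hits f a b c n ≤
      2 * ∑ j ∈ Finset.range (n + 1), (Icc q' q ∩ firstHit f a b c j).ncard := by
  have h1 : ∀ n, (firstHit f a b c n ∩ Iio q').ncard ≤
      ∑ j ∈ Finset.range n, (Icc q' q ∩ firstHit f a b c j).ncard := by
    intro n
    induction n with
    | zero =>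
      rw [h.firstHit_zero, singleton_inter_eq_empty.2 (by simpa using hq.mem'.2.le)]
      simp
    | succ n ih =>
      rw [Finset.sum_range_succ]
      exact (h.hits_succ_le hq n).1.trans (Nat.add_le_add_right ih _)
  rcases n with _ | n
  · rw [h.hits_zero]
    simp only [zero_add, Finset.range_one, Finset.sum_singleton, h.firstHit_zero]
    rw [inter_eq_right.2 (singleton_subset_iff.2
      (show c ∈ Icc q' q from ⟨hq.mem'.2.le, hq.mem.1.le⟩))]
    simp
  · have h2 := (h.hits_succ_le hq n).2
    have h3 := h1 n
    rw [Finset.sum_range_succ, Finset.sum_range_succ]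
    omega

lemma subexpHits_of_negSq (h : Uni f a b c) (hq : RevFix f a c q q') (hc : q' ≤ f (f c))
    (hs : SubexpHits (negSq f) (-q) (-q') (-c)) : SubexpHits f a b c := by
  intro x hx0 hx1
  obtain ⟨y, hxy, hy1⟩ := exists_between hx1
  have hy0 : 0 < y := hx0.trans hxy
  have hsum := hs (y ^ 2) (by positivity) (by nlinarith)
  set A := ∑' n, (hits (negSq f) (-q) (-q') (-c) n : ℝ) * (y ^ 2) ^ n with hA
  have hA0 : 0 ≤ A := tsum_nonneg fun n => by positivity
  have hJ : ∀ j, ((Icc q' q ∩ firstHit f a b c j).ncard : ℝ) * y ^ j ≤ A := by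
    intro j
    rcases Nat.even_or_odd' j with ⟨i, rfl | rfl⟩
    · rw [← h.hits_negSq hq hc, pow_mul]
      exact hsum.le_tsum i fun i _ => by positivity
    · rw [h.firstHit_inner_odd hq hc]; simpa using hA0
  have hbound : ∀ n, (hits f a b c n : ℝ) * x ^ n ≤ 2 * A * ((n + 1) * (x / y) ^ n) := by
    intro n
    have h1 : (hits f a b c n : ℝ) ≤
        2 * ∑ j ∈ Finset.range (n + 1), ((Icc q' q ∩ firstHit f a b c j).ncard : ℝ) := by
      exact_mod_cast h.hits_le_two_mul_sum hq n
    have h2 : (∑ j ∈ Finset.range (n + 1), ((Icc q' q ∩ firstHit f a b c j).ncard : ℝ)) * y ^ n ≤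
        (n + 1) * A := by
      rw [Finset.sum_mul]
      refine (Finset.sum_le_card_nsmul _ _ A fun j hj => (le_trans ?_ (hJ j))).trans_eq (by simp)
      have := pow_le_pow_of_le_one hy0.le hy1.le (Nat.lt_succ_iff.1 (Finset.mem_range.1 hj))
      gcongr
    have h3 : x ^ n = (x / y) ^ n * y ^ n := by rw [← mul_pow, div_mul_cancel₀ _ hy0.ne']
    calc (hits f a b c n : ℝ) * x ^ n
        ≤ (2 * ∑ j ∈ Finset.range (n + 1), ((Icc q' q ∩ firstHit f a b c j).ncard : ℝ))
          * x ^ n := by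
          gcongr
      _ = 2 * (x / y) ^ n * ((∑ j ∈ Finset.range (n + 1),
          ((Icc q' q ∩ firstHit f a b c j).ncard : ℝ)) * y ^ n) := by rw [h3]; ring
      _ ≤ 2 * (x / y) ^ n * ((n + 1) * A) := by gcongr
      _ = _ := by ring
  refine Summable.of_nonneg_of_le (fun n => by positivity) hbound (Summable.mul_left _ ?_)
  have hr : ‖x / y‖ < 1 := by
    rw [Real.norm_of_nonneg (by positivity)]; exact (div_lt_one hy0).2 hxy
  have h1 := summable_pow_mul_geometric_of_norm_lt_one 1 hr
  have h2 := summable_geometric_of_norm_lt_one hr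
  simpa [add_mul] using h1.add h2

lemma lt_of_subexpHits (h : Uni f a b c) (hs : SubexpHits f a b c) (hq : RevFix f a c q q') :
    q' < f (f c) := by
  by_contra! hcon
  have hqb : q < b := hq.mem.2.trans_le h.max_mem.2
  have hc1 : f c ∈ Icc c b := ⟨(hq.mem.1.trans hq.mem.2).le, h.max_mem.2⟩
  have hff : ContinuousOn (fun x => f (f x)) (Icc a b) := h.cont.comp h.cont h.maps
  have hgrow : ∀ n, 2 ^ n ≤ (Ioo q' q ∩ firstHit f a b c (2 * n)).ncard := by
    intro n
    induction n with
    | zero =>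
      rw [mul_zero, h.firstHit_zero,
        inter_eq_right.2 (singleton_subset_iff.2 (show c ∈ Ioo q' q from ⟨hq.mem'.2, hq.mem.1⟩))]
      simp
    | succ n ih =>
      set T := Ioo q' q ∩ firstHit f a b c (2 * n) with hT
      set T' := Ioo q' q ∩ firstHit f a b c (2 * (n + 1)) with hT'
      have hfin : T'.Finite := (h.finite_firstHit _).inter_of_right _
      have hpre : ∀ x ∈ Ioo q' q, x ≠ c → f (f x) ∈ T → x ∈ T' := by
        intro x hx hxc hxT
        have hxI : x ∈ Icc a b := ⟨hq.mem'.1.le.trans hx.1.le, hx.2.le.trans hqb.le⟩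
        refine ⟨hx, ?_⟩
        rw [show 2 * (n + 1) = 2 * n + 1 + 1 by ring, h.mem_firstHit_succ, h.mem_firstHit_succ]
        refine ⟨hxI, hxc, h.maps hxI, ?_, hxT.2⟩
        exact (hq.mem.1.trans_le (h.mapsTo_inner hq ⟨hx.1.le, hx.2.le⟩).1).ne'
      have hR : T ⊆ (fun x => f (f x)) '' (T' ∩ Ioi c) := by
        intro y hy
        obtain ⟨x, hx, hxy⟩ := intermediate_value_Ioo hq.mem.1.le
          (hff.mono (Icc_subset_Icc h.lt_left.le hqb.le))
          (show y ∈ Ioo _ _ from ⟨hcon.trans_lt hy.1.1, by simpa [hq.fix] using hy.1.2⟩)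
        simp only at hxy
        refine ⟨x, ⟨hpre x ⟨hq.mem'.2.trans hx.1, hx.2⟩ hx.1.ne' ?_, hx.1⟩, hxy⟩
        rw [hxy]; exact hy
      have hL : T ⊆ (fun x => f (f x)) '' (T' ∩ Iio c) := by
        intro y hy
        obtain ⟨x, hx, hxy⟩ := intermediate_value_Ioo' hq.mem'.2.le
          (hff.mono (Icc_subset_Icc hq.mem'.1.le h.lt_right.le))
          (show y ∈ Ioo _ _ from ⟨hcon.trans_lt hy.1.1, by simpa [hq.fix, hq.map'] using hy.1.2⟩)
        simp only at hxy
        refine ⟨x, ⟨hpre x ⟨hx.1, hx.2.trans hq.mem.1⟩ hx.2.ne ?_, hx.2⟩, hxy⟩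
        rw [hxy]; exact hy
      have h1 := (ncard_le_ncard hR ((hfin.inter_of_left _).image _)).trans
        (ncard_image_le (hfin.inter_of_left _))
      have h2 := (ncard_le_ncard hL ((hfin.inter_of_left _).image _)).trans
        (ncard_image_le (hfin.inter_of_left _))
      have hdis : Disjoint (T' ∩ Iio c) (T' ∩ Ioi c) :=
        disjoint_left.2 fun x hx hx' => lt_asymm (mem_Iio.1 hx.2) (mem_Ioi.1 hx'.2)
      have h3 := ncard_union_eq hdis (hfin.inter_of_left _) (hfin.inter_of_left _)
      have h4 := ncard_le_ncard (union_subset (inter_subset_left (s := T') (t := Iio c))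
        (inter_subset_left (s := T') (t := Ioi c))) hfin
      rw [pow_succ]
      omega
  have h1 := hs (9 / 10) (by norm_num) (by norm_num)
  have h2 := h1.comp_injective (mul_right_injective₀ (two_ne_zero : (2 : ℕ) ≠ 0))
  have h3 := h2.tendsto_atTop_zero.eventually (gt_mem_nhds one_pos)
  obtain ⟨n, hn⟩ := h3.exists
  simp only [Function.comp] at hn
  have h4 : (2 : ℝ) ^ n ≤ hits f a b c (2 * n) := by
    exact_mod_cast (hgrow n).trans (ncard_le_ncard inter_subset_right (h.finite_firstHit _))
  have h5 : (1 : ℝ) ≤ 2 ^ n * (9 / 10) ^ (2 * n) := by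
    rw [pow_mul, ← mul_pow]; exact one_le_pow₀ (by norm_num)
  have h6 : (2 : ℝ) ^ n * (9 / 10) ^ (2 * n) ≤ hits f a b c (2 * n) * (9 / 10) ^ (2 * n) := by
    gcongr
  linarith

lemma subexpHits_of_lt (h : Uni f a b c) (h1 : f c < c) : SubexpHits f a b c := by
  intro x _ _
  refine summable_of_ne_finset_zero (s := {0}) fun n hn => ?_
  obtain ⟨m, rfl⟩ := Nat.exists_eq_succ_of_ne_zero (by simpa using hn : n ≠ 0)
  have : firstHit f a b c (m + 1) = ∅ := by
    refine eq_empty_of_forall_notMem ?_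
    rintro y ⟨hy, hyc, -⟩
    rw [Function.iterate_succ_apply'] at hyc
    exact (((h.le_max (h.iterate_mem hy m)).trans_lt h1).ne) hyc
  simp [hits, this]

lemma subexpHits_of_gt_gt (h : Uni f a b c) (h1 : c < f c) (h2 : c < f (f c)) :
    SubexpHits f a b c := by
  have hstay : ∀ n, ∀ x ∈ Icc c (f c), c ≤ f^[n] x ∧ f^[n] x ≤ f c := by
    intro n
    induction n with
    | zero => exact fun x hx => hx
    | succ n ih =>
      intro x hx
      rw [Function.iterate_succ_apply']
      have h3 := ih x hx
      have h4 : f^[n] x ∈ Icc c b := ⟨h3.1, h3.2.trans h.max_mem.2⟩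
      exact ⟨h2.le.trans (h.anti.antitoneOn h4 ⟨h1.le, h.max_mem.2⟩ h3.2),
        h.le_max ⟨h.lt_left.le.trans h4.1, h4.2⟩⟩
  have hno : ∀ n, ∀ x ∈ firstHit f a b c (n + 1), x < f c → x < c := by
    intro n x hx hxc
    by_contra! hcx
    have h3 := hstay n x ⟨hcx, hxc.le⟩
    have h4 : f^[n] x ∈ Icc c b := ⟨h3.1, h3.2.trans h.max_mem.2⟩
    have h5 := hx.2.1
    rw [Function.iterate_succ_apply'] at h5
    have := h.anti.antitoneOn h4 ⟨h1.le, h.max_mem.2⟩ h3.2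
    linarith
  have hL : ∀ n, (firstHit f a b c n ∩ Iio (f c)).ncard ≤ 1 := by
    intro n
    induction n with
    | zero =>
      rw [h.firstHit_zero]
      exact (ncard_le_ncard inter_subset_left).trans (by simp)
    | succ n ih =>
      refine le_trans ?_ ih
      rw [← h.ncard_left ⟨h.lt_left.le, le_rfl⟩ n]
      exact ncard_le_ncard (fun x hx => ⟨hx.1, hno n x hx.1 hx.2⟩)
        ((h.finite_firstHit _).inter_of_left _)
  intro x hx0 hx1
  refine Summable.of_nonneg_of_le (fun n => by positivity) (fun n => ?_)
    ((summable_geometric_of_lt_one hx0.le hx1).mul_left 2)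
  have : hits f a b c n ≤ 2 := by
    rcases n with _ | n
    · simp [h.hits_zero]
    · rw [h.hits_succ]; have := hL n; omega
  have : (hits f a b c n : ℝ) ≤ 2 := by exact_mod_cast this
  gcongr

end Uni

/-- The first `N` signs `s n` of `c - f^[n+1] c` force subexponential growth of `hits`. -/
def ForcesSubexp (s : ℕ → ℝ) (N : ℕ) : Prop :=
  ∀ (f : ℝ → ℝ) (a b c : ℝ), Uni f a b c → (∀ n < N, 0 < s n * (c - f^[n + 1] c)) →
    SubexpHits f a b c

lemma forcesSubexp_one {s : ℕ → ℝ} (h0 : s 0 = 1) : ForcesSubexp s 1 := by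
  intro f a b c h hs
  have := hs 0 one_pos
  rw [h0] at this
  exact h.subexpHits_of_lt (by simpa using this)

lemma forcesSubexp_two {s : ℕ → ℝ} (h0 : s 0 = -1) (h1 : s 1 = -1) : ForcesSubexp s 2 := by
  intro f a b c h hs
  have h2 := hs 0 two_pos
  have h3 := hs 1 one_lt_two
  rw [h0] at h2
  rw [h1] at h3
  exact h.subexpHits_of_gt_gt (by simpa using h2) (by simpa using h3)

namespace Uni

variable {f : ℝ → ℝ} {a b c q q' : ℝ} {s : ℕ → ℝ}

lemma revFix_of_signs (h : Uni f a b c) (hs0 : s 0 = -1) (hs1 : s 1 = 1)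
    (h0 : 0 < s 0 * (c - f^[0 + 1] c)) (h1 : 0 < s 1 * (c - f^[1 + 1] c)) :
    ∃ q q', RevFix f a c q q' := by
  rw [hs0] at h0
  rw [hs1] at h1
  exact h.exists_revFix (by simpa using h0) (by simpa using h1)

lemma signs_negSq {N : ℕ} (hs : ∀ n < 2 * N, 0 < s n * (c - f^[n + 1] c)) :
    ∀ n < N, 0 < -s (2 * n + 1) * (-c - (negSq f)^[n + 1] (-c)) := by
  intro n hn
  rw [iterate_negSq, neg_neg]
  have := hs (2 * n + 1) (by omega)
  rw [show 2 * (n + 1) = 2 * n + 1 + 1 by ring]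
  linarith

lemma sign_even (h : Uni f a b c) (hq : RevFix f a c q q') (hc : q' ≤ f (f c)) {n : ℕ}
    (hsn : s (2 * n) = 1 ∨ s (2 * n) = -1) (hs : 0 < s (2 * n) * (c - f^[2 * n + 1] c)) :
    s (2 * n) = -1 := by
  refine hsn.resolve_left fun h1 => ?_
  rw [h1] at hs
  have := h.lt_iterate_odd hq hc ⟨hq.mem'.2.le, hq.mem.1.le⟩ n
  linarith

lemma gt_of_map_lt (h : Uni f a b c) (hq : RevFix f a c q q') {x : ℝ} (hx : x ∈ Icc a b)
    (hxc : c < x) (hf : f x < q) : q < x := by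
  by_contra! hcon
  have := h.anti.antitoneOn ⟨hxc.le, hx.2⟩
    ⟨hq.mem.1.le, (hq.mem.2.trans_le h.max_mem.2).le⟩ hcon
  rw [hq.fix] at this
  linarith

lemma lt_of_lt_map (h : Uni f a b c) (hq : RevFix f a c q q') {x : ℝ} (hx : x ∈ Icc a b)
    (hxc : c < x) (hf : q < f x) : x < q := by
  by_contra! hcon
  have := h.anti.antitoneOn ⟨hq.mem.1.le, (hq.mem.2.trans_le h.max_mem.2).le⟩
    ⟨hxc.le, hx.2⟩ hcon
  rw [hq.fix] at this
  linarith

/-- If the orbit of `c` stays to the right of `c` from time `3` until it first crosses to the left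
at an even time, then `f^[2]` maps the interval between `q'` and `q` into itself. -/
lemma lt_of_first_return (h : Uni f a b c) (hq : RevFix f a c q q') {m : ℕ}
    (h2 : f (f c) < c) (hm : ∀ i, 3 ≤ i → i < 2 * m + 4 → c < f^[i] c) (hlt : f^[2 * m + 4] c < c) :
    q' < f (f c) := by
  have hI : ∀ i, f^[i] c ∈ Icc a b := h.iterate_mem h.c_mem
  have back : ∀ j ≤ m, q < f^[2 * (m - j) + 3] c := by
    intro j
    induction j with
    | zero =>
      intro _
      refine h.gt_of_map_lt hq (hI _) (hm _ (by omega) (by omega)) ?_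
      rw [← Function.iterate_succ_apply' f]
      exact hlt.trans hq.mem.1
    | succ j ih =>
      intro hj
      have h4 := ih (by omega)
      rw [show 2 * (m - j) + 3 = 2 * (m - (j + 1)) + 4 + 1 by omega,
        Function.iterate_succ_apply'] at h4
      have h5 := h.lt_of_lt_map hq (hI _) (hm _ (by omega) (by omega)) h4
      rw [Function.iterate_succ_apply'] at h5
      exact h.gt_of_map_lt hq (hI _) (hm _ (by omega) (by omega)) h5
  have h3 := back m le_rfl
  rw [Nat.sub_self, mul_zero, zero_add, Function.iterate_succ_apply'] at h3
  by_contra! hcon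
  have h2I : f (f c) ∈ Icc a c := ⟨(hI 2).1, h2.le⟩
  have := h.mono.monotoneOn h2I ⟨hq.mem'.1.le, hq.mem'.2.le⟩ hcon
  rw [hq.map'] at this
  have h6 : f (f^[2] c) = f (f (f c)) := rfl
  linarith

lemma exists_forcesSubexp_of_eventually_one (h : Uni f a b c) (hsub : SubexpHits f a b c)
    (hs : ∀ n, (s n = 1 ∨ s n = -1) ∧ 0 < s n * (c - f^[n + 1] c))
    (hev : ∀ᶠ n in atTop, s n = 1) : ∃ N, ForcesSubexp s N := by
  rcases (hs 0).1 with h0 | h0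
  · exact ⟨1, forcesSubexp_one h0⟩
  rcases (hs 1).1 with h1 | h1
  · exfalso
    obtain ⟨q, q', hq⟩ := h.revFix_of_signs h0 h1 (hs 0).2 (hs 1).2
    have hc := (h.lt_of_subexpHits hsub hq).le
    obtain ⟨n, hn⟩ := eventually_atTop.1 hev
    have h2 := h.sign_even hq hc (hs (2 * n)).1 (hs (2 * n)).2
    have h3 := hn (2 * n) (by omega)
    linarith
  · exact ⟨2, forcesSubexp_two h0 h1⟩

/-- If the hits of `f` grow subexponentially and the signs along the critical orbit are eventually
periodic, then finitely many of these signs force subexponential growth. -/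
lemma exists_forcesSubexp (P : ℕ) : ∀ (f : ℝ → ℝ) (a b c : ℝ) (s : ℕ → ℝ), 1 ≤ P →
    Uni f a b c → SubexpHits f a b c →
    (∀ n, (s n = 1 ∨ s n = -1) ∧ 0 < s n * (c - f^[n + 1] c)) →
    (∀ᶠ n in atTop, s (n + P) = s n) → ∃ N, ForcesSubexp s N := by
  induction P using Nat.strong_induction_on with
  | _ P ih =>
  intro f a b c s hP h hsub hs hper
  rcases (hs 0).1 with h0 | h0
  · exact ⟨1, forcesSubexp_one h0⟩
  rcases (hs 1).1 with h1 | h1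
  swap
  · exact ⟨2, forcesSubexp_two h0 h1⟩
  obtain ⟨q, q', hq⟩ := h.revFix_of_signs h0 h1 (hs 0).2 (hs 1).2
  have hc := h.lt_of_subexpHits hsub hq
  have hF := h.uni_negSq hq hc.le
  have hFsub := h.subexpHits_negSq hsub hq hc.le
  have hEven : ∀ n, s (2 * n) = -1 := fun n => h.sign_even hq hc.le (hs _).1 (hs _).2
  set sF : ℕ → ℝ := fun n => -s (2 * n + 1) with hsF
  have hsF' : ∀ n, (sF n = 1 ∨ sF n = -1) ∧ 0 < sF n * (-c - (negSq f)^[n + 1] (-c)) := by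
    intro n
    refine ⟨?_, signs_negSq (N := n + 1) (fun m _ => (hs m).2) n (by omega)⟩
    rcases (hs (2 * n + 1)).1 with h2 | h2
    · exact Or.inr (by rw [hsF]; simp [h2])
    · exact Or.inl (by rw [hsF]; simp [h2])
  -- the renormalized signs
  have hNF : ∃ N, ForcesSubexp sF N := by
    obtain ⟨n₀, hn₀⟩ := eventually_atTop.1 hper
    rcases Nat.even_or_odd' P with ⟨P', rfl | rfl⟩
    · refine ih P' (by omega) _ _ _ _ sF (by omega) hF hFsub hsF' ?_
      filter_upwards [eventually_ge_atTop n₀] with n hn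
      have := hn₀ (2 * n + 1) (by omega)
      simp only [hsF]
      rw [← this]; congr 2; ring
    · refine hF.exists_forcesSubexp_of_eventually_one hFsub hsF' ?_
      filter_upwards [eventually_ge_atTop n₀] with n hn
      have h2 := hn₀ (2 * n + 1) (by omega)
      have h3 := hEven (n + P' + 1)
      rw [show 2 * (n + P' + 1) = 2 * n + 1 + (2 * P' + 1) by ring, h2] at h3
      simp [hsF, h3]
  -- a return to the left of `c`
  have hret : ∃ m, s (2 * m + 3) = 1 := by
    by_contra! hno
    have h2 : sF 0 = -1 := by simp [hsF, h1]
    have h3 : ∀ n, sF (n + 1) = 1 := fun n => by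
      have := ((hs (2 * n + 3)).1).resolve_left (hno n)
      simp only [hsF]
      rw [show 2 * (n + 1) + 1 = 2 * n + 3 by ring, this, neg_neg]
    obtain ⟨r, r', hr⟩ := hF.revFix_of_signs h2 (h3 0) (hsF' 0).2 (hsF' 1).2
    have h4 := (hF.lt_of_subexpHits hFsub hr).le
    have h5 := hF.sign_even hr h4 (hsF' (2 * 1)).1 (hsF' (2 * 1)).2
    have h6 := h3 1
    norm_num at h5 h6
    linarith
  classical
  obtain ⟨NF, hNF⟩ := hNF
  set m := Nat.find hret with hm
  have hm1 : s (2 * m + 3) = 1 := Nat.find_spec hret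
  have hmlt : ∀ i, 2 ≤ i → i < 2 * m + 3 → s i = -1 := by
    intro i hi him
    rcases Nat.even_or_odd' i with ⟨j, rfl | rfl⟩
    · exact hEven j
    · have := Nat.find_min hret (m := j - 1) (by omega)
      rw [show 2 * (j - 1) + 3 = 2 * j + 1 by omega] at this
      exact ((hs _).1).resolve_left this
  refine ⟨2 * m + 4 + 2 * NF, fun f' a' b' c' h' hs' => ?_⟩
  obtain ⟨r, r', hr⟩ := h'.revFix_of_signs h0 h1 (hs' 0 (by omega)) (hs' 1 (by omega))
  have hc' : r' < f' (f' c') := by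
    refine h'.lt_of_first_return hr (m := m) ?_ ?_ ?_
    · have := hs' 1 (by omega)
      rw [h1] at this
      simpa using this
    · intro i hi him
      have := hs' (i - 1) (by omega)
      rw [hmlt (i - 1) (by omega) (by omega), Nat.sub_add_cancel (by omega)] at this
      linarith
    · have := hs' (2 * m + 3) (by omega)
      rw [hm1] at this
      linarith
  refine h'.subexpHits_of_negSq hr hc'.le (hNF _ _ _ _ (h'.uni_negSq hr hc'.le) ?_)
  exact signs_negSq fun n hn => hs' n (by omega)

end Uni

section Shadowing

variable {f : ℝ → ℝ} {I : Set ℝ} {L p x : ℝ} {k : ℕ}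

/-- An orbit converging to a periodic orbit does so with a phase. -/
lemma exists_phase (hm : MapsTo f I I) (hL : ∀ y ∈ I, ∀ z ∈ I, |f y - f z| ≤ L * |y - z|)
    (hL0 : 0 ≤ L) (hp : p ∈ I) (hx : x ∈ I) (hper : f^[k] p = p)
    (hlim : ∀ ε > 0, ∀ᶠ n in atTop, ∃ i < k, |f^[n] x - f^[i] p| < ε) {ρ : ℝ} (hρ : 0 < ρ) :
    ∃ n₀, ∀ m, |f^[n₀ + m] x - f^[m] p| < ρ := by
  have hpI : ∀ i, f^[i] p ∈ I := fun i => hm.iterate i hp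
  have hxI : ∀ i, f^[i] x ∈ I := fun i => hm.iterate i hx
  have hk : 0 < k := by
    obtain ⟨n, i, hi, -⟩ := (hlim 1 one_pos).exists
    omega
  have hmod : ∀ i, f^[i % k] p = f^[i] p := fun i => by
    conv_rhs => rw [← Nat.mod_add_div i k, Function.iterate_add_apply, Function.iterate_mul,
      Function.iterate_fixed hper]
  obtain ⟨δ, hδ0, hδ⟩ : ∃ δ > 0, ∀ i < k, ∀ j < k, |f^[i] p - f^[j] p| < δ → f^[i] p = f^[j] p := by
    have hev : ∀ᶠ δ : ℝ in 𝓝[>] 0, ∀ i ∈ Finset.range k, ∀ j ∈ Finset.range k,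
        |f^[i] p - f^[j] p| < δ → f^[i] p = f^[j] p := by
      refine (Finset.eventually_all _).2 fun i _ => (Finset.eventually_all _).2 fun j _ => ?_
      by_cases hij : f^[i] p = f^[j] p
      · exact Eventually.of_forall fun _ _ => hij
      · have : 0 < |f^[i] p - f^[j] p| := abs_pos.2 (sub_ne_zero.2 hij)
        filter_upwards [nhdsWithin_le_nhds (Iio_mem_nhds this)] with δ h1 h2
        exact absurd h2 (not_lt.2 (le_of_lt h1))
    obtain ⟨δ, h1, h2⟩ := (hev.and self_mem_nhdsWithin).exists
    exact ⟨δ, h2, fun i hi j hj => h1 i (Finset.mem_range.2 hi) j (Finset.mem_range.2 hj)⟩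
  obtain ⟨ε, hε0, hερ, hεδ⟩ : ∃ ε > 0, ε ≤ ρ ∧ (L + 1) * ε < δ := by
    refine ⟨min ρ (δ / (L + 2)), by positivity, min_le_left _ _, ?_⟩
    calc (L + 1) * min ρ (δ / (L + 2)) ≤ (L + 1) * (δ / (L + 2)) := by
          gcongr; exact min_le_right _ _
      _ < δ := by
          rw [mul_div_assoc', div_lt_iff₀ (by positivity)]; nlinarith
  obtain ⟨n₁, hn₁⟩ := eventually_atTop.1 (hlim ε hε0)
  have hstep : ∀ n ≥ n₁, ∀ i, |f^[n] x - f^[i] p| < ε → |f^[n + 1] x - f^[i + 1] p| < ε := by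
    intro n hn i hi
    obtain ⟨j, hj, hjx⟩ := hn₁ (n + 1) (by omega)
    have h1 : |f^[n + 1] x - f^[i + 1] p| ≤ L * |f^[n] x - f^[i] p| := by
      rw [Function.iterate_succ_apply', Function.iterate_succ_apply']
      exact hL _ (hxI n) _ (hpI i)
    have h2 : |f^[(i + 1) % k] p - f^[j] p| < δ := by
      rw [hmod]
      calc |f^[i + 1] p - f^[j] p| ≤ |f^[n + 1] x - f^[i + 1] p| + |f^[n + 1] x - f^[j] p| := by
            rw [abs_sub_comm (f^[n + 1] x) (f^[i + 1] p)]
            exact abs_sub_le _ _ _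
        _ ≤ L * ε + ε := by
            refine add_le_add (h1.trans ?_) hjx.le
            gcongr
        _ < δ := by linarith
    rw [← hmod (i + 1), hδ _ (Nat.mod_lt _ hk) j hj h2]
    exact hjx
  obtain ⟨i, hi, hix⟩ := hn₁ n₁ le_rfl
  have hall : ∀ m, |f^[n₁ + m] x - f^[i + m] p| < ε := by
    intro m
    induction m with
    | zero => exact hix
    | succ m ih => exact hstep _ (Nat.le_add_right n₁ m) _ ih
  refine ⟨n₁ + (k - i), fun m => ?_⟩
  have h1 := hall (k - i + m)
  rw [← add_assoc, ← add_assoc, Nat.add_sub_cancel' hi.le, add_comm k m,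
    Function.iterate_add_apply f m k, hper] at h1
  exact h1.trans_le hερ

/-- Deviation of orbits of a perturbation over boundedly many steps. -/
lemma abs_iterate_sub_le {g : ℝ → ℝ} {τ : ℝ} (hm : MapsTo f I I) (hg : MapsTo g I I)
    (hL : ∀ y ∈ I, ∀ z ∈ I, |f y - f z| ≤ L * |y - z|) (hL0 : 0 ≤ L)
    (hgf : ∀ z ∈ I, |g z - f z| ≤ τ) {y z : ℝ} (hy : y ∈ I) (hz : z ∈ I) (i : ℕ) :
    |g^[i] y - f^[i] z| ≤ (L + 1) ^ i * (|y - z| + τ) := by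
  have hτ : 0 ≤ τ := (abs_nonneg _).trans (hgf y hy)
  induction i with
  | zero => simpa using hτ
  | succ i ih =>
    have hgy := hg.iterate i hy
    have hfz := hm.iterate i hz
    rw [Function.iterate_succ_apply', Function.iterate_succ_apply']
    have h1 : (1 : ℝ) ≤ (L + 1) ^ i := one_le_pow₀ (by linarith)
    have h2 : τ ≤ (L + 1) ^ i * (|y - z| + τ) := by nlinarith [abs_nonneg (y - z)]
    calc |g (g^[i] y) - f (f^[i] z)| ≤ |g (g^[i] y) - f (g^[i] y)| + |f (g^[i] y) - f (f^[i] z)| :=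
          abs_sub_le _ _ _
      _ ≤ τ + L * |g^[i] y - f^[i] z| := add_le_add (hgf _ hgy) (hL _ hgy _ hfz)
      _ ≤ (L + 1) ^ i * (|y - z| + τ) + L * ((L + 1) ^ i * (|y - z| + τ)) := by gcongr
      _ = _ := by ring

/-- Along an orbit attracted by a periodic orbit at which `f^[k]` is almost nonexpanding,
perturbed orbits separate slowly. -/
lemma exists_shadowing (hm : MapsTo f I I) (hL : ∀ y ∈ I, ∀ z ∈ I, |f y - f z| ≤ L * |y - z|)
    (hL0 : 0 ≤ L) (hp : p ∈ I) (hx : x ∈ I) (hper : f^[k] p = p)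
    (hlim : ∀ ε > 0, ∀ᶠ n in atTop, ∃ i < k, |f^[n] x - f^[i] p| < ε) {Λ : ℝ} (hΛ : 1 < Λ)
    (hloc : ∃ ρ > 0, ∀ y ∈ I, ∀ z ∈ I, |y - p| < ρ → |z - p| < ρ →
      |f^[k] y - f^[k] z| ≤ Λ * |y - z|) :
    ∃ B > 0, ∃ r > 0, ∀ (g : ℝ → ℝ) (τ y : ℝ), MapsTo g I I → (∀ z ∈ I, |g z - f z| ≤ τ) →
      y ∈ I → |y - x| ≤ τ → ∀ n, B * Λ ^ n * τ < r → |g^[n] y - f^[n] x| ≤ B * Λ ^ n * τ := by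
  obtain ⟨ρ, hρ, hloc⟩ := hloc
  obtain ⟨n₀, hn₀⟩ := exists_phase hm hL hL0 hp hx hper hlim (half_pos hρ)
  have hk : 0 < k := by
    obtain ⟨n, i, hi, -⟩ := (hlim 1 one_pos).exists
    omega
  set E := L + 1 with hE
  have hE1 : 1 ≤ E := by linarith
  set A := E ^ k / (Λ - 1) with hA
  have hΛ' : 0 < Λ - 1 := by linarith
  have hA0 : 0 < A := by positivity
  set B₀ := 2 * E ^ n₀ + A with hB₀
  have hB₀1 : 1 ≤ B₀ := by nlinarith [one_le_pow₀ hE1 (n := n₀)]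
  have hEk : 1 ≤ E ^ k := one_le_pow₀ hE1
  have hΛn : ∀ n : ℕ, 1 ≤ Λ ^ n := fun n => one_le_pow₀ hΛ.le
  refine ⟨2 * E ^ k * B₀, by positivity, ρ / 2, by positivity, ?_⟩
  intro g τ y hg hgf hy hyx n hn
  have hτ : 0 ≤ τ := (abs_nonneg _).trans hyx
  have hdev := fun {y z : ℝ} (hy : y ∈ I) (hz : z ∈ I) (i : ℕ) =>
    abs_iterate_sub_le hm hg hL hL0 hgf hy hz i
  have hinit : ∀ i, |g^[i] y - f^[i] x| ≤ 2 * E ^ i * τ := fun i => by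
    refine (hdev hy hx i).trans ?_
    have : 0 < E ^ i := by positivity
    nlinarith
  rcases lt_or_ge n n₀ with hlt | hge
  · refine (hinit n).trans ?_
    have h1 : E ^ n ≤ E ^ n₀ := pow_le_pow_right₀ hE1 hlt.le
    have h2 : 2 * E ^ n ≤ B₀ := by linarith
    calc 2 * E ^ n * τ ≤ B₀ * τ := by gcongr
      _ = 1 * B₀ * 1 * τ := by ring
      _ ≤ 2 * E ^ k * B₀ * Λ ^ n * τ := by
          gcongr
          · linarith
          · exact hΛn n
  set j := (n - n₀) / k with hj
  set i := (n - n₀) % k with hi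
  have hn_eq : n = i + (n₀ + k * j) := by
    have : i + k * j = n - n₀ := Nat.mod_add_div (n - n₀) k
    omega
  have hik : i < k := Nat.mod_lt _ hk
  have hjn : j ≤ n := (Nat.div_le_self _ _).trans (Nat.sub_le _ _)
  have hu : ∀ l ≤ j, |g^[n₀ + k * l] y - f^[n₀ + k * l] x| + A * τ ≤ Λ ^ l * B₀ * τ := by
    intro l
    induction l with
    | zero =>
      intro _
      have := hinit n₀
      simp only [mul_zero, add_zero, pow_zero, one_mul]
      rw [hB₀]; linarith
    | succ l ih =>
      intro hl
      have h1 := ih (by omega)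
      set u := f^[n₀ + k * l] x with hu
      set v := g^[n₀ + k * l] y with hv
      have hup : |u - p| < ρ / 2 := by
        have := hn₀ (k * l)
        rwa [Function.iterate_mul, Function.iterate_fixed hper] at this
      have huv : |v - u| < ρ / 2 := by
        refine lt_of_le_of_lt ?_ hn
        calc |v - u| ≤ Λ ^ l * B₀ * τ := by nlinarith
          _ ≤ Λ ^ n * B₀ * τ := by
              gcongr
              · exact hΛ.le
              · omega
          _ = 1 * B₀ * Λ ^ n * τ := by ring
          _ ≤ 2 * E ^ k * B₀ * Λ ^ n * τ := by gcongr; linarith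
      have hvp : |v - p| < ρ := by
        have := abs_sub_le v u p
        linarith
      have huI : u ∈ I := hm.iterate _ hx
      have hvI : v ∈ I := hg.iterate _ hy
      have h2 : |g^[k] v - f^[k] v| ≤ E ^ k * τ := by simpa using hdev hvI hvI k
      have h3 := hloc v hvI u huI hvp (by linarith)
      have h4 := abs_sub_le (g^[k] v) (f^[k] v) (f^[k] u)
      have hgk : g^[n₀ + k * (l + 1)] y = g^[k] v := by
        rw [hv, ← Function.iterate_add_apply, show k + (n₀ + k * l) = n₀ + k * (l + 1) by ring]
      have hfk : f^[n₀ + k * (l + 1)] x = f^[k] u := by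
        rw [hu, ← Function.iterate_add_apply, show k + (n₀ + k * l) = n₀ + k * (l + 1) by ring]
      rw [hgk, hfk, pow_succ]
      have h5 : E ^ k = A * (Λ - 1) := by rw [hA, div_mul_cancel₀ _ hΛ'.ne']
      have h6 : Λ * (|v - u| + A * τ) ≤ Λ * (Λ ^ l * B₀ * τ) := by gcongr
      rw [h5] at h2
      linarith
  have h1 := hu j le_rfl
  have h2 := hdev (hg.iterate (n₀ + k * j) hy) (hm.iterate (n₀ + k * j) hx) i
  rw [← Function.iterate_add_apply, ← Function.iterate_add_apply, ← hn_eq] at h2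
  refine h2.trans ?_
  have h3 : E ^ i ≤ E ^ k := pow_le_pow_right₀ hE1 hik.le
  have h4 : Λ ^ j ≤ Λ ^ n := pow_le_pow_right₀ hΛ.le hjn
  have h5 : τ ≤ Λ ^ n * B₀ * τ := by
    have := hΛn n
    have : 1 ≤ Λ ^ n * B₀ := by nlinarith
    nlinarith
  have h6 : |g^[n₀ + k * j] y - f^[n₀ + k * j] x| ≤ Λ ^ n * B₀ * τ := by
    calc _ ≤ Λ ^ j * B₀ * τ := by nlinarith
      _ ≤ _ := by gcongr
  calc E ^ i * (|g^[n₀ + k * j] y - f^[n₀ + k * j] x| + τ)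
      ≤ E ^ k * (Λ ^ n * B₀ * τ + Λ ^ n * B₀ * τ) := by gcongr
    _ = _ := by ring

/-- A point off a periodic orbit attracting it keeps a positive distance from its forward orbit. -/
lemma exists_dist_orbit_ge (hk : 0 < k)
    (hlim : ∀ ε > 0, ∀ᶠ n in atTop, ∃ i < k, |f^[n] x - f^[i] p| < ε)
    (hdisj : ∀ i < k, x ≠ f^[i] p) :
    ∃ r > 0, (∀ n, r ≤ |f^[n + 1] x - x|) ∧ ∀ i < k, r ≤ |x - f^[i] p| := by
  obtain ⟨d, hd0, hd⟩ : ∃ d > 0, ∀ i < k, d ≤ |x - f^[i] p| := by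
    have hne : (Finset.range k).Nonempty := ⟨0, Finset.mem_range.2 hk⟩
    obtain ⟨i, hi, hmin⟩ := Finset.exists_min_image (Finset.range k) (fun i => |x - f^[i] p|) hne
    exact ⟨|x - f^[i] p|, abs_pos.2 (sub_ne_zero.2 (hdisj i (Finset.mem_range.1 hi))),
      fun j hj => hmin j (Finset.mem_range.2 hj)⟩
  have hx : ∀ n, f^[n + 1] x ≠ x := by
    intro n hn
    obtain ⟨N, hN⟩ := eventually_atTop.1 (hlim d hd0)
    obtain ⟨i, hi, hlt⟩ := hN ((n + 1) * N) (by nlinarith)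
    rw [Function.iterate_mul, Function.iterate_fixed hn] at hlt
    exact absurd hlt (not_lt.2 (hd i hi))
  obtain ⟨N, hN⟩ := eventually_atTop.1 (hlim (d / 2) (half_pos hd0))
  have hne : (Finset.range (N + 1)).Nonempty := ⟨0, by simp⟩
  obtain ⟨m, hm, hmin⟩ := Finset.exists_min_image (Finset.range (N + 1))
    (fun n => |f^[n + 1] x - x|) hne
  have hm0 : 0 < |f^[m + 1] x - x| := abs_pos.2 (sub_ne_zero.2 (hx m))
  refine ⟨min (d / 2) |f^[m + 1] x - x|, by positivity, fun n => ?_, fun i hi => ?_⟩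
  · rcases lt_or_ge n (N + 1) with hlt | hge
    · exact (min_le_right _ _).trans (hmin n (Finset.mem_range.2 hlt))
    · refine (min_le_left _ _).trans ?_
      obtain ⟨i, hi, hlt⟩ := hN (n + 1) (by omega)
      have h1 := hd i hi
      have h2 := abs_sub_le x (f^[n + 1] x) (f^[i] p)
      rw [abs_sub_comm x (f^[n + 1] x)] at h2
      linarith
  · exact (min_le_left _ _).trans ((half_le_self hd0.le).trans (hd i hi))

end Shadowing

namespace Uni

variable {f g : ℝ → ℝ} {a b c c' τ : ℝ}

lemma abs_max_sub_le (h : Uni f a b c) (h' : Uni g a b c')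
    (hgf : ∀ z ∈ Icc a b, |g z - f z| ≤ τ) : |g c' - f c| ≤ τ := by
  have h1 := abs_le.1 (hgf c h.c_mem)
  have h2 := abs_le.1 (hgf c' h'.c_mem)
  have h3 := h.le_max h'.c_mem
  have h4 := h'.le_max h.c_mem
  rw [abs_le]
  constructor <;> linarith

/-- The turning point depends continuously on the map. -/
lemma exists_abs_turning_sub_lt (h : Uni f a b c) {r : ℝ} (hr : 0 < r) :
    ∃ τ₀ > 0, ∀ (g : ℝ → ℝ) (c' τ : ℝ), τ < τ₀ → Uni g a b c' →
      (∀ z ∈ Icc a b, |g z - f z| ≤ τ) → |c' - c| < r := by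
  obtain ⟨γ, hγ, hfar⟩ : ∃ γ > 0, ∀ x ∈ Icc a b, r ≤ |x - c| → f x ≤ f c - γ := by
    set S := Icc a b ∩ {x | r ≤ |x - c|} with hS
    have hScomp : IsCompact S := isCompact_Icc.inter_right
      (isClosed_le continuous_const (by fun_prop))
    rcases S.eq_empty_or_nonempty with hemp | hne
    · refine ⟨1, one_pos, fun x hx hxr => ?_⟩
      have : x ∈ S := ⟨hx, hxr⟩
      rw [hemp] at this
      exact this.elim
    · obtain ⟨z, hz, hmax⟩ := hScomp.exists_isMaxOn hne (h.cont.mono inter_subset_left)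
      have hzc : z ≠ c := by
        rintro rfl
        have : r ≤ |z - z| := hz.2
        simp at this
        linarith
      refine ⟨f c - f z, sub_pos.2 (h.lt_max hz.1 hzc), fun x hx hxr => ?_⟩
      have : f x ≤ f z := hmax ⟨hx, hxr⟩
      linarith
  refine ⟨γ / 2, half_pos hγ, fun g c' τ hτ h' hgf => ?_⟩
  by_contra! hcon
  have h1 := hfar c' h'.c_mem hcon
  have h2 := abs_le.1 (h.abs_max_sub_le h' hgf)
  have h3 := abs_le.1 (hgf c' h'.c_mem)
  linarith

lemma kneading_eq_of_pos (h : Uni f a b c) {e : ℕ → ℝ} (he : IsKneading f c e) {s : ℝ}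
    (hs : s = 1 ∨ s = -1) {n : ℕ} (hpos : 0 < s * (c - f^[n + 1] c)) : e n = s := by
  have hcont : ContinuousAt f^[n + 1] c :=
    (h.continuousOn_iterate (n + 1)).continuousAt (Icc_mem_nhds h.lt_left h.lt_right)
  have hev : ∀ᶠ x in 𝓝[≠] c, 0 < s * (c - f^[n + 1] x) := by
    refine nhdsWithin_le_nhds ?_
    have : ContinuousAt (fun x => s * (c - f^[n + 1] x)) c :=
      continuousAt_const.mul (continuousAt_const.sub hcont)
    exact this.eventually (lt_mem_nhds hpos)
  rcases hs with rfl | rfl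
  · refine he.eq_one_of_eventually (hev.mono fun x hx => ?_)
    linarith
  · refine he.eq_neg_one_of_eventually (hev.mono fun x hx => ?_)
    linarith

end Uni

/-- The critical orbit of `f` is attracted by the orbit of the `k`-periodic point `p`, without
hitting it, and `f^[k]` is almost nonexpanding near `p`. -/
structure SlowlyAttracted (f : ℝ → ℝ) (I : Set ℝ) (c p : ℝ) (k : ℕ) : Prop where
  pos : 0 < k
  lip : ∃ L, 0 ≤ L ∧ ∀ y ∈ I, ∀ z ∈ I, |f y - f z| ≤ L * |y - z|
  mem : p ∈ I
  per : f^[k] p = p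
  slow : ∀ Λ > 1, ∃ ρ > 0, ∀ y ∈ I, ∀ z ∈ I, |y - p| < ρ → |z - p| < ρ →
    |f^[k] y - f^[k] z| ≤ Λ * |y - z|
  lim : ∀ ε > 0, ∀ᶠ n in atTop, ∃ i < k, |f^[n] c - f^[i] p| < ε
  disj : ∀ i < k, c ≠ f^[i] p

namespace SlowlyAttracted

variable {f : ℝ → ℝ} {a b c p : ℝ} {k : ℕ} {s : ℕ → ℝ}

lemma exists_signs (h : Uni f a b c) (hs : SlowlyAttracted f (Icc a b) c p k) :
    ∃ s : ℕ → ℝ, (∀ n, (s n = 1 ∨ s n = -1) ∧ 0 < s n * (c - f^[n + 1] c)) ∧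
      ∀ᶠ n in atTop, s (n + k) = s n := by
  classical
  obtain ⟨r, hr, hr1, hr2⟩ := exists_dist_orbit_ge hs.pos hs.lim hs.disj
  obtain ⟨L, hL0, hL⟩ := hs.lip
  obtain ⟨n₀, hn₀⟩ := exists_phase h.maps hL hL0 hs.mem h.c_mem hs.per hs.lim hr
  have hr3 : ∀ i, r ≤ |c - f^[i] p| := fun i => by
    have := hr2 (i % k) (Nat.mod_lt _ hs.pos)
    rwa [show f^[i % k] p = f^[i] p by
      conv_rhs => rw [← Nat.mod_add_div i k, Function.iterate_add_apply, Function.iterate_mul,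
        Function.iterate_fixed hs.per]] at this
  have hside : ∀ m, f^[n₀ + m] c < c ↔ f^[m] p < c := by
    intro m
    have h1 := abs_lt.1 (hn₀ m)
    rcases le_abs.1 (hr3 m) with h2 | h2
    · exact ⟨fun _ => by linarith, fun _ => by linarith⟩
    · exact ⟨fun _ => by linarith, fun _ => by linarith⟩
  refine ⟨fun n => if f^[n + 1] c < c then 1 else -1, fun n => ?_, ?_⟩
  · by_cases hlt : f^[n + 1] c < c
    · beta_reduce
      rw [if_pos hlt]
      exact ⟨Or.inl rfl, by linarith⟩
    · have h1 := hr1 n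
      have h2 : f^[n + 1] c ≠ c := fun h2 => by rw [h2] at h1; simp at h1; linarith
      have h3 : c < f^[n + 1] c := lt_of_le_of_ne (not_lt.1 hlt) h2.symm
      beta_reduce
      rw [if_neg hlt]
      exact ⟨Or.inr rfl, by linarith⟩
  · filter_upwards [eventually_ge_atTop n₀] with n hn
    obtain ⟨m, rfl⟩ := Nat.exists_eq_add_of_le hn
    have h1 := hside (m + 1)
    have h2 := hside (m + 1 + k)
    rw [Function.iterate_add_apply f (m + 1) k, hs.per, ← h1] at h2
    rw [show n₀ + m + k + 1 = n₀ + (m + 1 + k) by ring, add_assoc n₀ m 1]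
    simp only [h2]

/-- Perturbations of size `τ` keep about `log (1 / τ)` signs of the critical orbit. -/
lemma exists_signs_agree (h : Uni f a b c) (ha : SlowlyAttracted f (Icc a b) c p k)
    (hs : ∀ n, (s n = 1 ∨ s n = -1) ∧ 0 < s n * (c - f^[n + 1] c)) {K : ℝ} (hK : 0 < K) :
    ∃ τ₁ > 0, ∀ (g : ℝ → ℝ) (c' τ : ℝ), 0 < τ → τ < τ₁ → Uni g a b c' →
      (∀ z ∈ Icc a b, |g z - f z| ≤ τ) → ∀ n : ℕ, n ≤ K * -Real.log τ →
      0 < s n * (c' - g^[n + 1] c') := by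
  obtain ⟨L, hL0, hL⟩ := ha.lip
  obtain ⟨r₀, hr₀, hdist, -⟩ := exists_dist_orbit_ge ha.pos ha.lim ha.disj
  obtain ⟨τ₀, hτ₀, hturn⟩ := h.exists_abs_turning_sub_lt (half_pos hr₀)
  have hlim' : ∀ ε > 0, ∀ᶠ n in atTop, ∃ i < k, |f^[n] (f c) - f^[i] p| < ε := fun ε hε =>
    (tendsto_add_atTop_nat 1).eventually (ha.lim ε hε)
  set Λ := Real.exp (1 / (2 * K)) with hΛdef
  have hΛ : 1 < Λ := Real.one_lt_exp_iff.2 (by positivity)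
  obtain ⟨B, hB, r, hr, hshadow⟩ := exists_shadowing h.maps hL hL0 ha.mem (h.maps h.c_mem) ha.per
    hlim' hΛ (ha.slow Λ hΛ)
  set w := min r (r₀ / 2) with hw
  have hw0 : 0 < w := by positivity
  refine ⟨min τ₀ ((w / B) ^ 2), by positivity, fun g c' τ hτ hτ1 h' hgf n hn => ?_⟩
  have hτ0 : τ < τ₀ := hτ1.trans_le (min_le_left _ _)
  have hτB : τ < (w / B) ^ 2 := hτ1.trans_le (min_le_right _ _)
  have hc' := hturn g c' τ hτ0 h' hgf
  have hsqrt : √τ < w / B := by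
    rw [Real.sqrt_lt' (by positivity)]; exact hτB
  have hpow : Λ ^ n * τ ≤ √τ := by
    have h1 : Λ ^ n ≤ (√τ)⁻¹ := by
      rw [hΛdef, ← Real.exp_nat_mul, ← Real.exp_log (inv_pos.2 (Real.sqrt_pos.2 hτ)),
        Real.exp_le_exp, Real.log_inv, Real.log_sqrt hτ.le]
      calc (n : ℝ) * (1 / (2 * K)) ≤ K * -Real.log τ * (1 / (2 * K)) := by gcongr
        _ = _ := by field_simp
    calc Λ ^ n * τ ≤ (√τ)⁻¹ * τ := by gcongr
      _ = (√τ)⁻¹ * (√τ * √τ) := by rw [Real.mul_self_sqrt hτ.le]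
      _ = √τ := by rw [← mul_assoc, inv_mul_cancel₀ (Real.sqrt_pos.2 hτ).ne', one_mul]
  have hlt : B * Λ ^ n * τ < w := by
    calc B * Λ ^ n * τ = B * (Λ ^ n * τ) := by ring
      _ ≤ B * √τ := by gcongr
      _ < B * (w / B) := by gcongr
      _ = w := by field_simp
  have hdev := hshadow g τ (g c') h'.maps hgf (h'.maps h'.c_mem) (h.abs_max_sub_le h' hgf) n
    (hlt.trans_le (min_le_left _ _))
  rw [← Function.iterate_succ_apply, ← Function.iterate_succ_apply] at hdev
  have h1 := abs_le.1 (hdev.trans (hlt.le.trans (min_le_right _ _)))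
  have h2 := abs_lt.1 hc'
  have h3 := hdist n
  obtain ⟨h4, h5⟩ := hs n
  simp only [Nat.succ_eq_add_one] at h1
  rcases h4 with h4 | h4
  · rw [h4] at h5 ⊢
    rw [abs_sub_comm, abs_of_pos (by linarith)] at h3
    linarith
  · rw [h4] at h5 ⊢
    rw [abs_of_pos (by linarith)] at h3
    linarith

end SlowlyAttracted

lemma abs_sub_le_of_abs_exp_sub_le {u v w : ℝ} (hu : u ≤ Real.log 3) (hv : v ≤ Real.log 3)
    (h : |Real.exp (-u) - Real.exp (-v)| ≤ w) : |u - v| ≤ 3 * w := by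
  have key : ∀ u v : ℝ, v ≤ Real.log 3 → |Real.exp (-u) - Real.exp (-v)| ≤ w →
      v - u ≤ 3 * w := by
    intro u v hv h
    have h1 := Real.add_one_le_exp (v - u)
    have h2 : Real.exp (v - u) = Real.exp (-u) * Real.exp v := by rw [← Real.exp_add]; ring_nf
    have h3 : Real.exp (-v) * Real.exp v = 1 := by rw [← Real.exp_add]; simp
    have h4 : Real.exp v ≤ 3 := by
      calc Real.exp v ≤ Real.exp (Real.log 3) := Real.exp_le_exp.2 hv
        _ = 3 := Real.exp_log (by norm_num)
    have h5 : (Real.exp (-u) - Real.exp (-v)) * Real.exp v ≤ w * 3 := by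
      have := (le_abs_self _).trans h
      have hw : 0 ≤ w := (abs_nonneg _).trans h
      have := Real.exp_pos v
      nlinarith
    linarith
  rw [abs_le]
  constructor
  · linarith [key u v hv h]
  · linarith [key v u hu (by rwa [abs_sub_comm])]

/-- The entropy is infinitely flat at a slowly attracted critical orbit. -/
theorem SlowlyAttracted.entropy_flat {f : ℝ → ℝ} {a b c p : ℝ} {k : ℕ} (h : Uni f a b c)
    (ha : SlowlyAttracted f (Icc a b) c p k) {β : ℝ} (hβ : 0 < β) :
    ∃ C > 0, ∃ τ₁ > 0, ∀ (g : ℝ → ℝ) (c' τ : ℝ), 0 < τ → τ < τ₁ → Uni g a b c' →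
      (∀ z ∈ Icc a b, |g z - f z| ≤ τ) →
      |(Dynamics.coverEntropy g (Icc a b)).toReal - (Dynamics.coverEntropy f (Icc a b)).toReal| ≤
        C * τ ^ β := by
  obtain ⟨s, hs, hper⟩ := ha.exists_signs h
  obtain ⟨H, hH⟩ : ∃ H, H = (Dynamics.coverEntropy f (Icc a b)).toReal := ⟨_, rfl⟩
  obtain ⟨hH0, hH3, hsum, hnsum⟩ := h.entropy_spec hH
  rw [← hH]
  rcases hH0.eq_or_lt with hzero | hpos
  · have hsub : SubexpHits f a b c := fun x hx0 hx1 => hsum x hx0 (by simpa [← hzero] using hx1)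
    obtain ⟨N, hN⟩ := Uni.exists_forcesSubexp k f a b c s ha.pos h hsub hs hper
    obtain ⟨τ₁, hτ₁, hagree⟩ := ha.exists_signs_agree h hs one_pos
    refine ⟨1, one_pos, min τ₁ (Real.exp (-N)), by positivity, ?_⟩
    intro g c' τ hτ hτ' h' hgf
    have hsub' := hN g a b c' h' fun n hn => by
      refine hagree g c' τ hτ (hτ'.trans_le (min_le_left _ _)) h' hgf n ?_
      have h1 := Real.log_le_log hτ (hτ'.le.trans (min_le_right _ _))
      rw [Real.log_exp] at h1
      have : (n : ℝ) ≤ N := by exact_mod_cast hn.le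
      linarith
    obtain ⟨H', hH'⟩ : ∃ H', H' = (Dynamics.coverEntropy g (Icc a b)).toReal := ⟨_, rfl⟩
    obtain ⟨hH0', -, -, hnsum'⟩ := h'.entropy_spec hH'
    have : H' = 0 := by
      by_contra hne
      have hlt : Real.exp (-H') < 1 := by
        rw [Real.exp_lt_one_iff]
        have := lt_of_le_of_ne hH0' (Ne.symm hne)
        linarith
      obtain ⟨x, hx1, hx2⟩ := exists_between hlt
      exact hnsum' x hx1 hx2 (hsub' x ((Real.exp_pos _).trans hx1) hx2)
    rw [← hH', this, ← hzero]
    simp only [sub_zero, abs_zero]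
    positivity
  · obtain ⟨e, he⟩ := h.exists_kneading
    have hR0 : Real.exp (-H) < 1 := by rw [Real.exp_lt_one_iff]; linarith
    obtain ⟨C, hC, ρ, hρ0, hρ1, hstab⟩ := (h.recip he).exists_radius_stable (Real.exp_pos (-H)) hR0
      (fun x hx0 hx1 => by
        rcases hx0.eq_or_lt with rfl | hx0
        · exact summable_of_ne_finset_zero (s := {0}) fun n hn => by
            rw [zero_pow (by simpa using hn), mul_zero]
        · exact hsum x hx0 hx1) hnsum
    have hlogρ : 0 < -Real.log ρ := by linarith [Real.log_neg hρ0 hρ1]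
    set K := β / -Real.log ρ with hKdef
    obtain ⟨τ₁, hτ₁, hagree⟩ := ha.exists_signs_agree h hs (show 0 < K by positivity)
    refine ⟨3 * (C * ρ⁻¹), by positivity, min τ₁ 1, by positivity, ?_⟩
    intro g c' τ hτ hτ' h' hgf
    have hlogτ : 0 ≤ -Real.log τ := by
      linarith [Real.log_nonpos hτ.le (hτ'.le.trans (min_le_right _ _))]
    have hKτ : 0 ≤ K * -Real.log τ := by positivity
    set N := ⌊K * -Real.log τ⌋₊ with hN
    have hNle : (N : ℝ) ≤ K * -Real.log τ := Nat.floor_le hKτ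
    have hNlt : K * -Real.log τ < N + 1 := Nat.lt_floor_add_one _
    obtain ⟨e', he'⟩ := h'.exists_kneading
    have hee : ∀ i < N, e' i = e i := fun i hi => by
      rw [h.kneading_eq_of_pos he (hs i).1 (hs i).2]
      refine h'.kneading_eq_of_pos he' (hs i).1 (hagree g c' τ hτ (hτ'.trans_le (min_le_left _ _))
        h' hgf i (le_trans ?_ hNle))
      exact_mod_cast hi.le
    obtain ⟨hS, hnS⟩ := hstab N _ _ (h'.recip he') (kneadCoeff_congr hee)
    obtain ⟨H', hH'⟩ : ∃ H', H' = (Dynamics.coverEntropy g (Icc a b)).toReal := ⟨_, rfl⟩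
    obtain ⟨hH0', hH3', hsum', hnsum'⟩ := h'.entropy_spec hH'
    have hR' : Real.exp (-H') ≤ 1 := Real.exp_le_one_iff.2 (by linarith)
    have hw : 0 < C * ρ ^ N := by positivity
    have hclose : |Real.exp (-H') - Real.exp (-H)| ≤ C * ρ ^ N := by
      rw [abs_le]
      constructor
      · by_contra! hcon
        obtain ⟨x, hx1, hx2⟩ := exists_between (show Real.exp (-H') < Real.exp (-H) - C * ρ ^ N by
          linarith)
        exact hnsum' x hx1 (by linarith) (hS x ((Real.exp_pos _).trans hx1).le hx2)
      · by_contra! hcon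
        obtain ⟨x, hx1, hx2⟩ := exists_between (show Real.exp (-H) + C * ρ ^ N < Real.exp (-H') by
          linarith)
        exact hnS x hx1 (hx2.trans_le hR') (hsum' x (by linarith [Real.exp_pos (-H)]) hx2)
    have hρN : ρ ^ N ≤ ρ⁻¹ * τ ^ β := by
      rw [← Real.exp_log hρ0, ← Real.exp_nat_mul, ← Real.exp_neg, Real.rpow_def_of_pos hτ,
        ← Real.exp_add, Real.exp_le_exp]
      have h1 : K * -Real.log ρ = β := by rw [hKdef, div_mul_cancel₀ _ hlogρ.ne']
      have h2 := mul_pos (sub_pos.2 hNlt) hlogρ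
      have h3 : Real.log τ * β = Real.log τ * (K * -Real.log ρ) := by rw [h1]
      linarith
    rw [← hH']
    refine (abs_sub_le_of_abs_exp_sub_le hH3' hH3 hclose).trans ?_
    calc 3 * (C * ρ ^ N) ≤ 3 * (C * (ρ⁻¹ * τ ^ β)) := by gcongr
      _ = _ := by ring

/-- The map `f` in the coordinate `x ↦ -x`. -/
def conjNeg (f : ℝ → ℝ) (x : ℝ) : ℝ := -f (-x)

lemma conjNeg_iterate (f : ℝ → ℝ) (n : ℕ) (x : ℝ) : (conjNeg f)^[n] x = -f^[n] (-x) := by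
  have h : Function.Semiconj Neg.neg f (conjNeg f) := fun y => by simp [conjNeg]
  have := (h.iterate_right n).eq (-x)
  rw [neg_neg] at this
  exact this.symm

lemma neg_mem_Icc_neg_one_one {x : ℝ} (hx : x ∈ Icc (-1 : ℝ) 1) : -x ∈ Icc (-1 : ℝ) 1 :=
  ⟨by linarith [hx.2], by linarith [hx.1]⟩

lemma image_neg_Icc_neg_one_one : Neg.neg '' Icc (-1 : ℝ) 1 = Icc (-1) 1 := by
  rw [image_neg_eq_neg, neg_Icc, neg_neg]

lemma coverEntropy_conjNeg (f : ℝ → ℝ) :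
    Dynamics.coverEntropy (conjNeg f) (Icc (-1) 1) = Dynamics.coverEntropy f (Icc (-1) 1) := by
  have h1 : Function.Semiconj Neg.neg f (conjNeg f) := fun y => by simp [conjNeg]
  have h2 : Function.Semiconj Neg.neg (conjNeg f) f := fun y => by simp [conjNeg]
  have hu : UniformContinuous (Neg.neg : ℝ → ℝ) := uniformContinuous_neg
  refine le_antisymm ?_ ?_
  · conv_lhs => rw [← image_neg_Icc_neg_one_one]
    exact Dynamics.coverEntropy_image_le_of_uniformContinuous h1 hu _
  · conv_lhs => rw [← image_neg_Icc_neg_one_one]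
    exact Dynamics.coverEntropy_image_le_of_uniformContinuous h2 hu _

lemma SlowlyAttracted.conjNeg {f : ℝ → ℝ} {c p : ℝ} {k : ℕ}
    (h : SlowlyAttracted f (Icc (-1) 1) c p k) :
    SlowlyAttracted (conjNeg f) (Icc (-1) 1) (-c) (-p) k where
  pos := h.pos
  lip := by
    obtain ⟨L, hL0, hL⟩ := h.lip
    refine ⟨L, hL0, fun y hy z hz => ?_⟩
    have := hL _ (neg_mem_Icc_neg_one_one hy) _ (neg_mem_Icc_neg_one_one hz)
    rw [show -y - -z = -(y - z) by ring, abs_neg] at this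
    rwa [_root_.conjNeg, _root_.conjNeg,
      show -f (-y) - -f (-z) = -(f (-y) - f (-z)) by ring, abs_neg]
  mem := neg_mem_Icc_neg_one_one h.mem
  per := by rw [conjNeg_iterate, neg_neg, h.per]
  slow Λ hΛ := by
    obtain ⟨ρ, hρ, hs⟩ := h.slow Λ hΛ
    refine ⟨ρ, hρ, fun y hy z hz hyp hzp => ?_⟩
    have := hs _ (neg_mem_Icc_neg_one_one hy) _ (neg_mem_Icc_neg_one_one hz)
      (by rwa [← abs_neg, show -(-y - p) = y - -p by ring])
      (by rwa [← abs_neg, show -(-z - p) = z - -p by ring])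
    rw [show -y - -z = -(y - z) by ring, abs_neg] at this
    rwa [conjNeg_iterate, conjNeg_iterate, ← abs_neg,
      show -(-f^[k] (-y) - -f^[k] (-z)) = f^[k] (-y) - f^[k] (-z) by ring]
  lim ε hε := by
    filter_upwards [h.lim ε hε] with n hn
    obtain ⟨i, hi, hlt⟩ := hn
    refine ⟨i, hi, ?_⟩
    rwa [conjNeg_iterate, conjNeg_iterate, neg_neg, neg_neg, ← abs_neg,
      show -(-f^[n] c - -f^[i] p) = f^[n] c - f^[i] p by ring]
  disj i hi := by
    rw [conjNeg_iterate, neg_neg]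
    exact fun he => h.disj i hi (neg_injective he)

namespace C2UnimodalWith

variable {g : ℝ → ℝ} {c : ℝ}

lemma uni_of_map_neg_one (h : C2UnimodalWith g c) (hg : g (-1) = -1) : Uni g (-1) 1 c := by
  obtain ⟨hc, hm, -, h1, hC, -, hmono⟩ := h
  have hcI : c ∈ Icc (-1 : ℝ) 1 := ⟨hc.1.le, hc.2.le⟩
  rcases hmono with ⟨hl, hr⟩ | ⟨hl, hr⟩
  · refine ⟨hc.1, hc.2, hm, hC.continuousOn, hl, hr, hg, ?_⟩
    have h2 := hr (left_mem_Icc.2 hc.2.le) (right_mem_Icc.2 hc.2.le) hc.2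
    have h3 := (hm hcI).2
    rcases h1 with h1 | h1
    · exact h1
    · have h1' : g 1 = 1 := h1
      linarith
  · have h2 := hl (left_mem_Icc.2 hc.1.le) (right_mem_Icc.2 hc.1.le) hc.1
    have h3 := (hm hcI).1
    linarith

lemma conjNeg (h : C2UnimodalWith g c) (hg : g (-1) = 1) : Uni (conjNeg g) (-1) 1 (-c) := by
  obtain ⟨hc, hm, -, h1, hC, -, hmono⟩ := h
  have hcI : c ∈ Icc (-1 : ℝ) 1 := ⟨hc.1.le, hc.2.le⟩
  rcases hmono with ⟨hl, hr⟩ | ⟨hl, hr⟩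
  · have h2 := hl (left_mem_Icc.2 hc.1.le) (right_mem_Icc.2 hc.1.le) hc.1
    have h3 := (hm hcI).2
    linarith
  · have hg1 : g 1 = 1 := by
      have h2 := hr (left_mem_Icc.2 hc.2.le) (right_mem_Icc.2 hc.2.le) hc.2
      have h3 := (hm hcI).1
      rcases h1 with h1 | h1
      · have h1' : g 1 = -1 := h1
        linarith
      · exact h1
    refine ⟨by linarith [hc.2], by linarith [hc.1],
      fun x hx => neg_mem_Icc_neg_one_one (hm (neg_mem_Icc_neg_one_one hx)),
      (hC.continuousOn.comp continuousOn_neg fun x hx => neg_mem_Icc_neg_one_one hx).neg,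
      fun x hx y hy hxy => neg_lt_neg (hr ⟨?_, ?_⟩ ⟨?_, ?_⟩ (neg_lt_neg hxy)),
      fun x hx y hy hxy => neg_lt_neg (hl ⟨?_, ?_⟩ ⟨?_, ?_⟩ (neg_lt_neg hxy)),
      by simp [_root_.conjNeg, hg1], by simp [_root_.conjNeg, hg]⟩ <;>
    linarith [hx.1, hx.2, hy.1, hy.2]

lemma entropyOn_mem (h : C2UnimodalWith g c) :
    0 ≤ entropyOn g (Icc (-1) 1) ∧ entropyOn g (Icc (-1) 1) ≤ Real.log 3 := by
  rcases h.2.2.1 with hg | hg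
  · obtain ⟨h0, h3, -⟩ := (h.uni_of_map_neg_one hg).entropy_spec rfl
    exact ⟨h0, h3⟩
  · obtain ⟨h0, h3, -⟩ := (h.conjNeg hg).entropy_spec rfl
    rw [coverEntropy_conjNeg] at h0 h3
    exact ⟨h0, h3⟩

/-- Entropy is flat at `f` among the unimodal maps of the same orientation. -/
lemma entropyOn_flat {f : ℝ → ℝ} {p : ℝ} {k : ℕ} (h : C2UnimodalWith f c)
    (ha : SlowlyAttracted f (Icc (-1) 1) c p k) {β : ℝ} (hβ : 0 < β) :
    ∃ C > 0, ∃ τ₁ > 0, ∀ (g : ℝ → ℝ) (c' τ : ℝ), 0 < τ → τ < τ₁ → C2UnimodalWith g c' →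
      (∀ z ∈ Icc (-1 : ℝ) 1, |g z - f z| ≤ τ) →
      |entropyOn g (Icc (-1) 1) - entropyOn f (Icc (-1) 1)| ≤ C * τ ^ β := by
  have key : ∀ g : ℝ → ℝ, ∀ τ c' : ℝ, τ < 1 → C2UnimodalWith g c' →
      (∀ z ∈ Icc (-1 : ℝ) 1, |g z - f z| ≤ τ) → g (-1) = f (-1) := by
    intro g τ c' hτ hg hgf
    have h1 := abs_le.1 (hgf (-1) (by norm_num))
    have hf := h.2.2.1
    have hg' := hg.2.2.1
    rw [mem_insert_iff, mem_singleton_iff] at hf hg'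
    rcases hf with hf | hf <;> rcases hg' with hg' | hg' <;> linarith [h1.1, h1.2]
  rcases h.2.2.1 with hf | hf
  · obtain ⟨C, hC, τ₁, hτ₁, H⟩ := ha.entropy_flat (h.uni_of_map_neg_one hf) hβ
    refine ⟨C, hC, min τ₁ 1, lt_min hτ₁ one_pos, fun g c' τ hτ hτ' hg hgf => ?_⟩
    exact H g c' τ hτ (hτ'.trans_le (min_le_left _ _)) (hg.uni_of_map_neg_one
      ((key g τ c' (hτ'.trans_le (min_le_right _ _)) hg hgf).trans hf)) hgf
  · obtain ⟨C, hC, τ₁, hτ₁, H⟩ := ha.conjNeg.entropy_flat (h.conjNeg hf) hβ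
    refine ⟨C, hC, min τ₁ 1, lt_min hτ₁ one_pos, fun g c' τ hτ hτ' hg hgf => ?_⟩
    have := H (_root_.conjNeg g) (-c') τ hτ (hτ'.trans_le (min_le_left _ _)) (hg.conjNeg
      ((key g τ c' (hτ'.trans_le (min_le_right _ _)) hg hgf).trans hf)) fun z hz => by
        rw [_root_.conjNeg, _root_.conjNeg, ← abs_neg,
          show -(-g (-z) - -f (-z)) = g (-z) - f (-z) by ring]
        exact hgf _ (neg_mem_Icc_neg_one_one hz)
    rwa [coverEntropy_conjNeg, coverEntropy_conjNeg] at this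

end C2UnimodalWith

/-- A `C¹` map on an interval is almost `1`-Lipschitz near a point of derivative `±1`. -/
lemma exists_abs_sub_le_of_abs_deriv_eq_one {F : ℝ → ℝ} {p Λ : ℝ}
    (hF : ContDiffOn ℝ 1 F (Icc (-1) 1)) (hp : p ∈ Icc (-1 : ℝ) 1) (hd : |deriv F p| = 1)
    (hΛ : 1 < Λ) :
    ∃ ρ > 0, ∀ y ∈ Icc (-1 : ℝ) 1, ∀ z ∈ Icc (-1 : ℝ) 1, |y - p| < ρ → |z - p| < ρ →
      |F y - F z| ≤ Λ * |y - z| := by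
  have hu : UniqueDiffOn ℝ (Icc (-1 : ℝ) 1) := uniqueDiffOn_Icc (by norm_num)
  have hdiff : DifferentiableAt ℝ F p := differentiableAt_of_deriv_ne_zero fun h0 => by
    rw [h0] at hd; simp at hd
  have hcont := hF.continuousOn_derivWithin hu le_rfl
  have h1 : ‖derivWithin F (Icc (-1) 1) p‖ < Λ := by
    rw [hdiff.derivWithin (hu p hp), Real.norm_eq_abs, hd]; exact hΛ
  obtain ⟨ρ, hρ, hball⟩ := Metric.mem_nhdsWithin_iff.1
    ((hcont p hp).norm.eventually (gt_mem_nhds h1))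
  refine ⟨ρ, hρ, fun y hy z hz hyp hzp => ?_⟩
  have hconv : Convex ℝ (Metric.ball p ρ ∩ Icc (-1 : ℝ) 1) :=
    (convex_ball p ρ).inter (convex_Icc _ _)
  refine hconv.norm_image_sub_le_of_norm_hasDerivWithin_le (f' := derivWithin F (Icc (-1) 1))
    (fun x hx => ((hF.differentiableOn one_ne_zero x hx.2).hasDerivWithinAt).mono
      inter_subset_right) (fun x hx => le_of_lt (hball hx)) ⟨?_, hz⟩ ⟨?_, hy⟩
  · rwa [Metric.mem_ball, Real.dist_eq]
  · rwa [Metric.mem_ball, Real.dist_eq]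

lemma ContDiffOn.iterate_of_mapsTo {f : ℝ → ℝ} {I : Set ℝ} (hf : ContDiffOn ℝ 1 f I)
    (hm : MapsTo f I I) (n : ℕ) : ContDiffOn ℝ 1 f^[n] I := by
  induction n with
  | zero => exact contDiffOn_id
  | succ n ih => exact ih.comp hf hm

lemma exists_lipschitz_of_contDiffOn {F : ℝ × ℝ → ℝ}
    (hF : ContDiffOn ℝ 2 F (Icc (-1 : ℝ) 1 ×ˢ Icc (0 : ℝ) 1)) :
    ∃ L, 0 < L ∧ ∀ x ∈ Icc (-1 : ℝ) 1 ×ˢ Icc (0 : ℝ) 1, ∀ y ∈ Icc (-1 : ℝ) 1 ×ˢ Icc (0 : ℝ) 1,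
      |F x - F y| ≤ L * ‖x - y‖ := by
  set s := Icc (-1 : ℝ) 1 ×ˢ Icc (0 : ℝ) 1
  have hu : UniqueDiffOn ℝ s :=
    (uniqueDiffOn_Icc (by norm_num)).prod (uniqueDiffOn_Icc (by norm_num))
  have hconv : Convex ℝ s := (convex_Icc _ _).prod (convex_Icc _ _)
  have hcont := hF.continuousOn_fderivWithin hu (by norm_num)
  obtain ⟨L, hL⟩ := (isCompact_Icc.prod isCompact_Icc).exists_bound_of_continuousOn hcont
  refine ⟨max L 1, by positivity, fun x hx y hy => ?_⟩
  exact hconv.norm_image_sub_le_of_norm_fderivWithin_le (hF.differentiableOn two_ne_zero)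
    (fun z hz => (hL z hz).trans (le_max_left _ _)) hy hx

/-- Theorem (infinite flatness of entropy at parabolic parameters).
Let `G` be a C² family of C² unimodal maps `g_t` of `I = [-1,1]` such that `g_0` has a
parabolic periodic point `p` whose orbit attracts, but is disjoint from, the critical orbit.
Then the Hölder exponent of `h : t ↦ h_top(g_t)` at `t = 0` is infinite. -/
theorem entropy_infinitely_flat_at_parabolic
    (G : ℝ → ℝ → ℝ)
    -- G is C² on I × [0,1]
    (hC2 : ContDiffOn ℝ 2 (fun q : ℝ × ℝ => G q.1 q.2)
      (Set.Icc (-1 : ℝ) 1 ×ˢ Set.Icc (0 : ℝ) 1))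
    -- each g_t is a C² unimodal map with some turning point c_t
    (huni : ∀ t ∈ Set.Icc (0 : ℝ) 1, ∃ ct, C2UnimodalWith (fun x => G x t) ct)
    (c : ℝ) (hc : C2UnimodalWith (fun x => G x 0) c)
    -- parabolic periodic point of g_0
    (p : ℝ) (hp : p ∈ Set.Icc (-1 : ℝ) 1) (k : ℕ) (hk : 1 ≤ k)
    (hper : (fun x => G x 0)^[k] p = p)
    (hmult : |deriv ((fun x => G x 0)^[k]) p| = 1)
    -- the orbit of p attracts the critical orbit
    (hattract : Filter.Tendsto
      (fun n : ℕ => Metric.infDist ((fun x => G x 0)^[n] c)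
        {y : ℝ | ∃ i < k, (fun x => G x 0)^[i] p = y})
      Filter.atTop (nhds 0))
    -- the critical orbit is disjoint from the orbit of p
    (hdisj : ∀ n : ℕ, (fun x => G x 0)^[n] c ∉
      {y : ℝ | ∃ i < k, (fun x => G x 0)^[i] p = y}) :
    ∀ β : ℝ, 0 < β → ∃ C : ℝ, 0 < C ∧ ∀ t ∈ Set.Icc (0 : ℝ) 1,
      |entropyOn (fun x => G x t) (Set.Icc (-1 : ℝ) 1) -
        entropyOn (fun x => G x 0) (Set.Icc (-1 : ℝ) 1)| ≤ C * t ^ β := by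
  intro β hβ
  obtain ⟨L, hL0, hL⟩ := exists_lipschitz_of_contDiffOn hC2
  have hf1 : ContDiffOn ℝ 1 (fun x => G x 0) (Icc (-1) 1) := hc.2.2.2.2.1.of_le (by norm_num)
  have ha : SlowlyAttracted (fun x => G x 0) (Icc (-1) 1) c p k :=
    { pos := hk
      lip := ⟨L, hL0.le, fun y hy z hz => by
        simpa [Prod.norm_def] using hL (y, 0) ⟨hy, by simp⟩ (z, 0) ⟨hz, by simp⟩⟩
      mem := hp
      per := hper
      slow := fun Λ hΛ =>
        exists_abs_sub_le_of_abs_deriv_eq_one (hf1.iterate_of_mapsTo hc.2.1 k) hp hmult hΛ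
      lim := fun ε hε => by
        filter_upwards [hattract.eventually (gt_mem_nhds hε)] with n hn
        obtain ⟨y, ⟨i, hi, rfl⟩, hlt⟩ := (Metric.infDist_lt_iff
          (show {y : ℝ | ∃ i < k, (fun x => G x 0)^[i] p = y}.Nonempty from ⟨p, 0, hk, rfl⟩)).1 hn
        exact ⟨i, hi, by rwa [← Real.dist_eq]⟩
      disj := fun i hi he => hdisj 0 ⟨i, hi, he.symm⟩ }
  obtain ⟨C, hC, τ₁, hτ₁, H⟩ := hc.entropyOn_flat ha hβ
  have ht₀ : 0 < τ₁ / L := by positivity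
  have hlog : 0 ≤ Real.log 3 := Real.log_nonneg (by norm_num)
  refine ⟨C * L ^ β + Real.log 3 / (τ₁ / L) ^ β, by positivity, fun t ht => ?_⟩
  rcases ht.1.eq_or_lt with rfl | ht0
  · rw [sub_self, abs_zero, Real.zero_rpow hβ.ne', mul_zero]
  obtain ⟨ct, hct⟩ := huni t ht
  rw [add_mul]
  rcases lt_or_ge t (τ₁ / L) with hlt | hge
  · have h1 := H _ ct (L * t) (by positivity) (by rw [lt_div_iff₀ hL0] at hlt; linarith) hct
      fun z hz => by
        have := hL (z, t) ⟨hz, ht⟩ (z, 0) ⟨hz, by simp⟩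
        simpa [Prod.norm_def, abs_of_pos ht0, ht0.le] using this
    rw [Real.mul_rpow hL0.le ht0.le, ← mul_assoc] at h1
    have : 0 ≤ Real.log 3 / (τ₁ / L) ^ β * t ^ β := by positivity
    linarith
  · have h0 := hc.entropyOn_mem
    have h1 := hct.entropyOn_mem
    have h2 : |entropyOn (fun x => G x t) (Icc (-1) 1) - entropyOn (fun x => G x 0) (Icc (-1) 1)|
        ≤ Real.log 3 := abs_le.2 ⟨by linarith [h0.2, h1.1], by linarith [h0.1, h1.2]⟩
    have h3 : Real.log 3 ≤ Real.log 3 / (τ₁ / L) ^ β * t ^ β := by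
      rw [div_mul_eq_mul_div, le_div_iff₀ (by positivity)]
      gcongr
    have h4 : 0 ≤ C * L ^ β * t ^ β := by positivity
    linarith
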